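/- arXiv:math/9808057 — 6 statements merged into one kernel-verified Lean document; each statement's English description precedes it below -/
import Mathlib

section
/- Let m, n be positive integers. The set of badly approximable systems of affine forms is thick in M_{m,n}(ℝ) × ℝ^m: for every nonempty open subset W of M_{m,n}(ℝ) × ℝ^m (identified with ℝ^{mn+m}), the Hausdorff dimension of W ∩ { ⟨A,b⟩ : ⟨A,b⟩ is badly approximable } equals mn + m. -/
open MeasureTheory Filter

noncomputable section

/-- The vector of real entries of an integer vector. -/
def intCast {k : ℕ} (q : Fin k → ℤ) : Fin k → ℝ := fun i => (q i : ℝ)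

/-- The value `Aq + b + p` of the system of affine forms `⟨A, b⟩` at `q`, shifted by `p`. -/
def affForm {m n : ℕ} (A : Fin m → Fin n → ℝ) (b : Fin m → ℝ)
    (q : Fin n → ℤ) (p : Fin m → ℤ) : Fin m → ℝ :=
  fun i => (∑ j, A i j * (q j : ℝ)) + b i + (p i : ℝ)

/-- The system of affine forms `⟨A, b⟩` is badly approximable if
`‖Aq + b + p‖^m ‖q‖^n ≥ c > 0` for all `p ∈ ℤ^m` and all `q ∈ ℤ^n` of sufficiently
large norm.  (Here `‖·‖` is the sup norm.) -/
def IsBadlyApproximable {m n : ℕ} (A : Fin m → Fin n → ℝ) (b : Fin m → ℝ) : Prop :=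
  ∃ c > (0 : ℝ), ∃ T : ℝ, ∀ p : Fin m → ℤ, ∀ q : Fin n → ℤ,
    T ≤ ‖intCast q‖ → c ≤ ‖affForm A b q p‖ ^ m * ‖intCast q‖ ^ n

open scoped ENNReal NNReal Topology

/-- If a map expands distances up to a Hölder exponent `r`, then it cannot decrease the Hausdorff
dimension by more than the factor `r`. -/
theorem le_dimH_image_of_edist_le {X Y : Type*} [EMetricSpace X] [EMetricSpace Y] {C r : ℝ≥0}
    {s : Set X} {h : X → Y} (hr : 0 < r)
    (hh : ∀ x ∈ s, ∀ y ∈ s, edist x y ≤ C * edist (h x) (h y) ^ (r : ℝ)) :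
    r * dimH s ≤ dimH (h '' s) := by
  rcases s.eq_empty_or_nonempty with rfl | ⟨x₀, -⟩
  · simp
  have : Nonempty X := ⟨x₀⟩
  have hinj : Set.InjOn h s := by
    intro x hx y hy hxy
    have := hh x hx y hy
    rw [hxy, edist_self, ENNReal.zero_rpow_of_pos (by exact_mod_cast hr), mul_zero] at this
    exact edist_le_zero.1 this
  have hinv := hinj.leftInvOn_invFunOn
  have hold : HolderOnWith C r (Function.invFunOn h s) (h '' s) := by
    rintro _ ⟨x, hx, rfl⟩ _ ⟨y, hy, rfl⟩
    rw [hinv hx, hinv hy]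
    exact hh x hx y hy
  have := hold.dimH_image_le hr
  rw [hinv.image_image, ENNReal.le_div_iff_mul_le (by left; simpa using hr.ne') (by simp)] at this
  rwa [mul_comm]

/-- A Fubini-type inequality for Hausdorff measures: almost all slices of a set which is null for
the `(d + s)`-dimensional Hausdorff measure are null for the `s`-dimensional one. -/
theorem ae_hausdorffMeasure_slice_eq_zero {X Y : Type*} [EMetricSpace X] [MeasurableSpace X]
    [BorelSpace X] [EMetricSpace Y] [MeasurableSpace Y] [BorelSpace Y]
    [MeasurableSpace (X × Y)] [BorelSpace (X × Y)]
    {μ : Measure X} {d s : ℝ} (hd : 0 ≤ d) (hs : 0 < s)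
    (hμ : ∀ S : Set X, μ S ≤ Metric.ediam S ^ d) {E : Set (X × Y)}
    (hE : Measure.hausdorffMeasure (d + s) E = 0) :
    ∀ᵐ x ∂μ, Measure.hausdorffMeasure s {y | (x, y) ∈ E} = 0 := by
  have hcover : ∀ k : ℕ, ∃ t : ℕ → Set (X × Y), E ⊆ ⋃ i, t i ∧
      (∀ i, Metric.ediam (t i) ≤ ((k : ℝ≥0∞) + 1)⁻¹) ∧
      ∑' i, ⨆ _ : (t i).Nonempty, Metric.ediam (t i) ^ (d + s) < 2⁻¹ ^ k := by
    intro k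
    rw [Measure.hausdorffMeasure_apply] at hE
    have h0 : (0 : ℝ≥0∞) < ((k : ℝ≥0∞) + 1)⁻¹ := by simp
    have h1 := (iSup₂_eq_bot.1 hE) _ h0
    have h2 : (0 : ℝ≥0∞) < 2⁻¹ ^ k := ENNReal.pow_pos (by simp) k
    rw [← bot_eq_zero, ← h1] at h2
    simp only [iInf_lt_iff] at h2
    obtain ⟨t, ht1, ht2, ht3⟩ := h2
    exact ⟨t, ht1, ht2, ht3⟩
  choose t htE htd hts using hcover
  let c : ℕ → ℕ → Set X := fun k i => closure (Prod.fst '' t k i)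
  let f : ℕ → X → ℝ≥0∞ := fun k x =>
    ∑' i, (c k i).indicator (fun _ => Metric.ediam (t k i) ^ s) x
  have hmeas : ∀ k i, Measurable ((c k i).indicator fun _ => Metric.ediam (t k i) ^ s) :=
    fun k i => measurable_const.indicator isClosed_closure.measurableSet
  have hfm : ∀ k, Measurable (f k) := fun k => Measurable.tsum (hmeas k)
  have hint : ∀ k, ∫⁻ x, f k x ∂μ ≤ 2⁻¹ ^ k := by
    intro k
    rw [lintegral_tsum fun i => (hmeas k i).aemeasurable]
    refine le_trans (ENNReal.tsum_le_tsum fun i => ?_) (hts k).le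
    rw [lintegral_indicator_const isClosed_closure.measurableSet]
    rcases (t k i).eq_empty_or_nonempty with h | h
    · simp [h]
    · simp only [h, iSup_pos]
      rw [ENNReal.rpow_add_of_nonneg _ _ hd hs.le, mul_comm]
      gcongr
      refine (hμ _).trans ?_
      gcongr
      rw [Metric.ediam_closure]
      simpa using LipschitzWith.prod_fst.ediam_image_le (t k i)
  have hsum : ∫⁻ x, ∑' k, f k x ∂μ ≠ ∞ := by
    rw [lintegral_tsum fun k => (hfm k).aemeasurable]
    refine ne_top_of_le_ne_top ?_ (ENNReal.tsum_le_tsum hint)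
    rw [ENNReal.tsum_geometric]
    simp
  filter_upwards [ae_lt_top (Measurable.tsum hfm) hsum] with x hx
  have hlim : Tendsto (fun k => f k x) atTop (𝓝 0) :=
    ENNReal.tendsto_atTop_zero_of_tsum_ne_top hx.ne
  have hr : Tendsto (fun k : ℕ => ((k : ℝ≥0∞) + 1)⁻¹) atTop (𝓝 0) := by
    have := (tendsto_add_atTop_iff_nat 1).2 ENNReal.tendsto_inv_nat_nhds_zero
    simpa using this
  have hsub : ∀ k i, Metric.ediam {y | (x, y) ∈ t k i} ≤ Metric.ediam (t k i) := by
    intro k i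
    refine Metric.ediam_le fun y hy z hz => ?_
    refine le_trans ?_ (Metric.edist_le_ediam_of_mem hy hz)
    simp [Prod.edist_eq]
  have hle := Measure.hausdorffMeasure_le_liminf_tsum s {y | (x, y) ∈ E} _ hr
    (fun k i => {y | (x, y) ∈ t k i})
    (Eventually.of_forall fun k i => (hsub k i).trans (htd k i))
    (Eventually.of_forall fun k y hy => by
      simpa using Set.mem_iUnion.1 (htE k hy))
  refine le_antisymm (hle.trans ?_) bot_le
  rw [← hlim.liminf_eq]
  refine liminf_le_liminf (Eventually.of_forall fun k => ENNReal.tsum_le_tsum fun i => ?_)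
  rcases Set.eq_empty_or_nonempty {y | (x, y) ∈ t k i} with h | ⟨y, hy⟩
  · simp [h, hs]
  · have hxy : (x, y) ∈ t k i := hy
    rw [Set.indicator_of_mem (subset_closure (Set.mem_image_of_mem Prod.fst hxy))]
    gcongr
    exact hsub k i

theorem volume_matrix_le_ediam_pow {m n : ℕ} (S : Set (Fin m → Fin n → ℝ)) :
    volume S ≤ Metric.ediam S ^ ((m * n : ℕ) : ℝ) := by
  calc volume S ≤ volume (Set.pi Set.univ fun i => Function.eval i '' S) :=
        measure_mono (Set.subset_pi_eval_image _ _)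
    _ = ∏ i, volume (Function.eval i '' S) := by rw [volume_pi, Measure.pi_pi]
    _ ≤ ∏ _i : Fin m, Metric.ediam S ^ n := by
        refine Finset.prod_le_prod' fun i _ => ?_
        refine (Real.volume_pi_le_diam_pow _).trans ?_
        rw [Fintype.card_fin]
        gcongr
        simpa using (LipschitzWith.eval i).ediam_image_le S
    _ = Metric.ediam S ^ ((m * n : ℕ) : ℝ) := by
        rw [Finset.prod_const, Finset.card_univ, Fintype.card_fin, ENNReal.rpow_natCast, ← pow_mul,
          mul_comm]

/-- The distance from `yᵗA` to the nearest integer point. -/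
def dualDist {m n : ℕ} (A : Fin m → Fin n → ℝ) (y : Fin m → ℤ) : ℝ :=
  ‖fun j => (∑ i, A i j * (y i : ℝ)) - round (∑ i, A i j * (y i : ℝ))‖

theorem dualDist_le {m n : ℕ} {A : Fin m → Fin n → ℝ} {y : Fin m → ℤ} {r : ℝ} (hr : 0 ≤ r)
    (h : ∀ j, ∃ z : ℤ, |(∑ i, A i j * (y i : ℝ)) - z| ≤ r) : dualDist A y ≤ r := by
  refine (pi_norm_le_iff_of_nonneg hr).2 fun j => ?_
  obtain ⟨z, hz⟩ := h j
  exact (round_le _ z).trans hz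

theorem abs_sub_round_le_dualDist {m n : ℕ} (A : Fin m → Fin n → ℝ) (y : Fin m → ℤ) (j : Fin n) :
    |(∑ i, A i j * (y i : ℝ)) - round (∑ i, A i j * (y i : ℝ))| ≤ dualDist A y :=
  norm_le_pi_norm (fun j => (∑ i, A i j * (y i : ℝ)) - round (∑ i, A i j * (y i : ℝ))) j

theorem dualDist_smul_le {m n : ℕ} (A : Fin m → Fin n → ℝ) (y : Fin m → ℤ) (k : ℕ) :
    dualDist A (fun i => k * y i) ≤ k * dualDist A y := by
  refine dualDist_le (mul_nonneg k.cast_nonneg (norm_nonneg _)) fun j =>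
    ⟨k * round (∑ i, A i j * (y i : ℝ)), ?_⟩
  have h : (∑ i, A i j * (((k : ℤ) * y i : ℤ) : ℝ)) = k * ∑ i, A i j * (y i : ℝ) := by
    rw [Finset.mul_sum]
    refine Finset.sum_congr rfl fun i _ => ?_
    push_cast
    ring
  rw [h]
  push_cast
  rw [← mul_sub, abs_mul, Nat.abs_cast]
  gcongr
  exact abs_sub_round_le_dualDist A y j

/-- The Dirichlet theorem on simultaneous approximation for the transposed matrix. -/
theorem exists_dualDist_le {m n : ℕ} (A : Fin m → Fin n → ℝ) {T : ℕ} {τ : ℝ} (hn : 0 < n)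
    (hτ : 1 < τ) (h : τ ^ n = (T : ℝ) ^ m) :
    ∃ y : Fin m → ℤ, y ≠ 0 ∧ (∀ i, |y i| < T) ∧ dualDist A y ≤ 2 / τ := by
  obtain ⟨L, hL⟩ : ∃ L, ⌈τ⌉₊ = L + 1 :=
    Nat.exists_eq_succ_of_ne_zero (Nat.ceil_pos.2 (by linarith)).ne'
  have hL1 : (L : ℝ) < τ := Nat.lt_ceil.1 (by omega)
  have hL2 : τ ≤ L + 1 := by
    have := Nat.le_ceil τ
    rw [hL] at this
    exact_mod_cast this
  have hLpos : 0 < L := by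
    rcases Nat.eq_zero_or_pos L with h0 | h0
    · subst h0
      norm_num at hL2
      linarith
    · exact h0
  have hLR : (1 : ℝ) ≤ L := by exact_mod_cast hLpos
  let X : (Fin m → Fin T) → Fin n → ℝ := fun y j => ∑ i, A i j * ((y i : ℕ) : ℝ)
  let F : (Fin m → Fin T) → Fin n → Fin L := fun y j =>
    ⟨⌊Int.fract (X y j) * L⌋₊, by
      rw [Nat.floor_lt (by positivity)]
      have := Int.fract_lt_one (X y j)
      nlinarith⟩
  have hcard : Fintype.card (Fin n → Fin L) < Fintype.card (Fin m → Fin T) := by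
    simp only [Fintype.card_pi, Fintype.card_fin, Finset.prod_const, Finset.card_univ]
    have : (L : ℝ) ^ n < (T : ℝ) ^ m := by
      rw [← h]
      exact pow_lt_pow_left₀ hL1 (by positivity) hn.ne'
    exact_mod_cast this
  obtain ⟨y, y', hne, hF⟩ := Fintype.exists_ne_map_eq_of_card_lt F hcard
  refine ⟨fun i => (y i : ℤ) - (y' i : ℤ), ?_, ?_, ?_⟩
  · intro h0
    apply hne
    ext i
    have := congrFun h0 i
    simp only [Pi.zero_apply] at this
    omega
  · intro i
    have h1 := (y i).2
    have h2 := (y' i).2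
    change |(y i : ℤ) - (y' i : ℤ)| < T
    rw [abs_lt]
    constructor <;> omega
  · refine dualDist_le (by positivity) fun j => ⟨⌊X y j⌋ - ⌊X y' j⌋, ?_⟩
    have hXX : (∑ i, A i j * ((((y i : ℕ) : ℤ) - ((y' i : ℕ) : ℤ) : ℤ) : ℝ)) = X y j - X y' j := by
      simp only [X]
      rw [← Finset.sum_sub_distrib]
      refine Finset.sum_congr rfl fun i _ => ?_
      push_cast
      ring
    rw [hXX]
    have hj : ⌊Int.fract (X y j) * L⌋₊ = ⌊Int.fract (X y' j) * L⌋₊ :=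
      congrArg Fin.val (congrFun hF j)
    have a1 := Nat.floor_le (mul_nonneg (Int.fract_nonneg (X y j)) (Nat.cast_nonneg (α := ℝ) L))
    have a2 := Nat.lt_floor_add_one (Int.fract (X y j) * L)
    have a3 := Nat.floor_le (mul_nonneg (Int.fract_nonneg (X y' j)) (Nat.cast_nonneg (α := ℝ) L))
    have a4 := Nat.lt_floor_add_one (Int.fract (X y' j) * L)
    rw [hj] at a1 a2
    have e : X y j - X y' j - ((⌊X y j⌋ - ⌊X y' j⌋ : ℤ) : ℝ) =
        Int.fract (X y j) - Int.fract (X y' j) := by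
      rw [Int.fract, Int.fract]
      push_cast
      ring
    rw [e]
    have hb : |Int.fract (X y j) - Int.fract (X y' j)| * L ≤ 1 := by
      rw [← Nat.abs_cast L, ← abs_mul, abs_le]
      constructor <;> nlinarith
    rw [le_div_iff₀ (by linarith)]
    nlinarith [abs_nonneg (Int.fract (X y j) - Int.fract (X y' j))]

theorem norm_intCast_le_iff {k : ℕ} {y : Fin k → ℤ} {r : ℝ} (hr : 0 ≤ r) :
    ‖intCast y‖ ≤ r ↔ ∀ i, |(y i : ℝ)| ≤ r :=
  pi_norm_le_iff_of_nonneg hr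

theorem one_le_norm_intCast {k : ℕ} {y : Fin k → ℤ} (hy : y ≠ 0) : 1 ≤ ‖intCast y‖ := by
  obtain ⟨i, hi⟩ := Function.ne_iff.1 hy
  refine le_trans ?_ (norm_le_pi_norm (intCast y) i)
  have : 1 ≤ |y i| := Int.one_le_abs hi
  rw [intCast, Real.norm_eq_abs]
  exact_mod_cast this

theorem finite_norm_intCast_le (k : ℕ) (r : ℕ) : {y : Fin k → ℤ | ‖intCast y‖ ≤ r}.Finite := by
  refine (Set.finite_Icc (fun _ => -(r : ℤ)) (fun _ => (r : ℤ))).subset fun y hy => ?_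
  have h := (norm_intCast_le_iff (Nat.cast_nonneg r)).1 hy
  have h' : ∀ i, |y i| ≤ r := fun i => by exact_mod_cast h i
  exact ⟨fun i => (abs_le.1 (h' i)).1, fun i => (abs_le.1 (h' i)).2⟩

/-- There is a lacunary sequence of integer vectors, starting at any prescribed scale, that
contains approximations to the transposed matrix which are, up to a constant, as good as those
given by the Dirichlet theorem. -/
theorem exists_lacunary {m n : ℕ} (A : Fin m → Fin n → ℝ) (hm : 0 < m) (hn : 0 < n) {R : ℕ}
    (hR : 2 ≤ R) (k₀ : ℕ) {θ : ℝ} (hθ : 1 < θ) (h : θ ^ n = (R : ℝ) ^ m) :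
    ∃ w : ℕ → Fin m → ℤ,
      (∀ j, (R : ℝ) ^ (k₀ + j) ≤ ‖intCast (w j)‖ ∧ ‖intCast (w j)‖ < (R : ℝ) ^ (k₀ + j + 1)) ∧
      ∀ J, ∃ j ≤ J, dualDist A (w j) ≤ 2 * R ^ k₀ / θ ^ (J + 1) := by
  have hR1 : (1 : ℝ) < R := by exact_mod_cast (by omega : 1 < R)
  let S : ℕ → Set (Fin m → ℤ) := fun j =>
    {y | (R : ℝ) ^ (k₀ + j) ≤ ‖intCast y‖ ∧ ‖intCast y‖ < (R : ℝ) ^ (k₀ + j + 1)}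
  have hfin : ∀ j, (S j).Finite := fun j =>
    (finite_norm_intCast_le m (R ^ (k₀ + j + 1))).subset fun y hy => by
      simpa using hy.2.le
  have hne : ∀ j, (S j).Nonempty := by
    intro j
    have : Nonempty (Fin m) := ⟨⟨0, hm⟩⟩
    have e : ‖intCast (fun _ : Fin m => (R : ℤ) ^ (k₀ + j))‖ = (R : ℝ) ^ (k₀ + j) := by
      have : intCast (fun _ : Fin m => (R : ℤ) ^ (k₀ + j)) = fun _ => (R : ℝ) ^ (k₀ + j) := by
        ext i
        simp [intCast]
      rw [this, pi_norm_const, norm_pow, Real.norm_natCast]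
    refine ⟨fun _ => (R : ℤ) ^ (k₀ + j), ?_, ?_⟩
    · rw [e]
    · rw [e]
      exact pow_lt_pow_right₀ hR1 (by omega)
  have hmin : ∀ j, ∃ w ∈ S j, ∀ y ∈ S j, dualDist A w ≤ dualDist A y := fun j =>
    Set.exists_min_image (S j) (dualDist A) (hfin j) (hne j)
  choose w hwS hwmin using hmin
  refine ⟨w, hwS, fun J => ?_⟩
  obtain ⟨y, hy0, hyT, hyd⟩ := exists_dualDist_le A (T := R ^ (J + 1)) (τ := θ ^ (J + 1)) hn
    (one_lt_pow₀ hθ (by omega)) (by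
      push_cast
      rw [← pow_mul, mul_comm, pow_mul, h, ← pow_mul, ← pow_mul, mul_comm])
  have hnorm : ‖intCast (fun i => ((R ^ k₀ : ℕ) : ℤ) * y i)‖ = (R : ℝ) ^ k₀ * ‖intCast y‖ := by
    have : intCast (fun i => ((R ^ k₀ : ℕ) : ℤ) * y i) = ((R : ℝ) ^ k₀) • intCast y := by
      ext i
      simp [intCast]
    rw [this, norm_smul, norm_pow, Real.norm_natCast]
  have hylt : ‖intCast y‖ < (R : ℝ) ^ (J + 1) := by
    refine (pi_norm_lt_iff (by positivity)).2 fun i => ?_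
    rw [intCast, Real.norm_eq_abs]
    exact_mod_cast hyT i
  have hy1 := one_le_norm_intCast hy0
  have hpos : (0 : ℝ) < R ^ k₀ := by positivity
  obtain ⟨l, hl1, hl2⟩ := exists_nat_pow_near (x := (R : ℝ) ^ k₀ * ‖intCast y‖) (y := R)
    (one_le_mul_of_one_le_of_one_le (one_le_pow₀ hR1.le) hy1) hR1
  have hkl : k₀ < l + 1 := by
    refine (pow_lt_pow_iff_right₀ hR1).1 (lt_of_le_of_lt ?_ hl2)
    nlinarith
  have hlJ : l < k₀ + (J + 1) := by
    refine (pow_lt_pow_iff_right₀ hR1).1 (lt_of_le_of_lt hl1 ?_)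
    rw [pow_add]
    gcongr
  obtain ⟨j, rfl⟩ : ∃ j, l = k₀ + j := ⟨l - k₀, by omega⟩
  refine ⟨j, by omega, ?_⟩
  calc dualDist A (w j) ≤ dualDist A (fun i => ((R ^ k₀ : ℕ) : ℤ) * y i) :=
        hwmin j _ ⟨by rw [hnorm]; exact hl1, by rw [hnorm]; exact hl2⟩
    _ ≤ ((R ^ k₀ : ℕ) : ℝ) * dualDist A y := dualDist_smul_le A y _
    _ ≤ (R : ℝ) ^ k₀ * (2 / θ ^ (J + 1)) := by
        push_cast
        gcongr
    _ = 2 * R ^ k₀ / θ ^ (J + 1) := by ring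

theorem sum_mul_affForm {m n : ℕ} (A : Fin m → Fin n → ℝ) (b : Fin m → ℝ) (q : Fin n → ℤ)
    (p w : Fin m → ℤ) :
    ∑ i, (w i : ℝ) * affForm A b q p i =
      (∑ j, (q j : ℝ) * ∑ i, A i j * (w i : ℝ)) + (∑ i, b i * (w i : ℝ))
        + ∑ i, (w i : ℝ) * (p i : ℝ) := by
  have : ∑ j, (q j : ℝ) * ∑ i, A i j * (w i : ℝ) = ∑ i, (w i : ℝ) * ∑ j, A i j * (q j : ℝ) := by
    simp only [Finset.mul_sum]
    rw [Finset.sum_comm]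
    refine Finset.sum_congr rfl fun i _ => Finset.sum_congr rfl fun j _ => ?_
    ring
  rw [this, ← Finset.sum_add_distrib, ← Finset.sum_add_distrib]
  refine Finset.sum_congr rfl fun i _ => ?_
  rw [affForm]
  ring

/-- The transference inequality. -/
theorem le_norm_affForm_of_dual {m n : ℕ} {A : Fin m → Fin n → ℝ} {b : Fin m → ℝ} {w : Fin m → ℤ}
    {γ : ℝ} (hb : ∀ p : ℤ, γ ≤ |∑ i, b i * (w i : ℝ) + p|) (q : Fin n → ℤ) (p : Fin m → ℤ) :
    γ ≤ n * ‖intCast q‖ * dualDist A w + m * ‖intCast w‖ * ‖affForm A b q p‖ := by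
  let z : Fin n → ℤ := fun j => round (∑ i, A i j * (w i : ℝ))
  have h1 := hb (∑ j, q j * z j + ∑ i, w i * p i)
  have e : ∑ i, b i * (w i : ℝ) + ((∑ j, q j * z j + ∑ i, w i * p i : ℤ) : ℝ) =
      ∑ i, (w i : ℝ) * affForm A b q p i
        - ∑ j, (q j : ℝ) * ((∑ i, A i j * (w i : ℝ)) - z j) := by
    rw [sum_mul_affForm]
    simp only [mul_sub, Finset.sum_sub_distrib]
    push_cast
    ring
  rw [e] at h1
  have h2 : |∑ i, (w i : ℝ) * affForm A b q p i| ≤ m * ‖intCast w‖ * ‖affForm A b q p‖ := by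
    refine (Finset.abs_sum_le_sum_abs _ _).trans ((Finset.sum_le_card_nsmul _ _
      (‖intCast w‖ * ‖affForm A b q p‖) fun i _ => ?_).trans ?_)
    · rw [abs_mul]
      exact mul_le_mul (norm_le_pi_norm (intCast w) i) (norm_le_pi_norm (affForm A b q p) i)
        (abs_nonneg _) (norm_nonneg _)
    · simp [mul_assoc]
  have h3 : |∑ j, (q j : ℝ) * ((∑ i, A i j * (w i : ℝ)) - z j)| ≤
      n * ‖intCast q‖ * dualDist A w := by
    refine (Finset.abs_sum_le_sum_abs _ _).trans ((Finset.sum_le_card_nsmul _ _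
      (‖intCast q‖ * dualDist A w) fun j _ => ?_).trans ?_)
    · rw [abs_mul]
      exact mul_le_mul (norm_le_pi_norm (intCast q) j) (abs_sub_round_le_dualDist A w j)
        (abs_nonneg _) (norm_nonneg _)
    · simp [mul_assoc]
  linarith [abs_sub (∑ i, (w i : ℝ) * affForm A b q p i)
    (∑ j, (q j : ℝ) * ((∑ i, A i j * (w i : ℝ)) - z j))]

theorem isBadlyApproximable_of_dual {m n : ℕ} {A : Fin m → Fin n → ℝ} {b : Fin m → ℝ}
    (hm : 0 < m) (hn : 0 < n) {w : ℕ → Fin m → ℤ} {R θ C γ : ℝ} {k₀ : ℕ} (hR : 1 < R) (hθ : 1 < θ)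
    (h : θ ^ n = R ^ m) (hC : 0 < C) (hγ : 0 < γ)
    (hw : ∀ j, ‖intCast (w j)‖ < R ^ (k₀ + j + 1))
    (hA : ∀ J, ∃ j ≤ J, dualDist A (w j) ≤ C / θ ^ (J + 1))
    (hb : ∀ j, ∀ p : ℤ, γ ≤ |∑ i, b i * (w j i : ℝ) + p|) : IsBadlyApproximable A b := by
  have hmR : (0 : ℝ) < m := by exact_mod_cast hm
  have hnR : (0 : ℝ) < n := by exact_mod_cast hn
  refine ⟨(γ / (2 * m * R ^ (k₀ + 1))) ^ m * (γ / (2 * n * C)) ^ n, by positivity,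
    γ / (2 * n * C) + 1, fun p q hq => ?_⟩
  have hex : ∃ k : ℕ, n * ‖intCast q‖ * C / θ ^ (k + 1) ≤ γ / 2 := by
    obtain ⟨k, hk⟩ := pow_unbounded_of_one_lt (n * ‖intCast q‖ * C / (γ / 2)) hθ
    refine ⟨k, ?_⟩
    rw [div_lt_iff₀ (by positivity)] at hk
    rw [div_le_iff₀ (by positivity), pow_succ]
    have : 0 < θ ^ k := by positivity
    nlinarith [mul_pos this (half_pos hγ)]
  have hk := Nat.find_spec hex
  have hlt : γ / 2 < n * ‖intCast q‖ * C / θ ^ Nat.find hex := by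
    rcases Nat.eq_zero_or_pos (Nat.find hex) with h0 | h0
    · rw [h0, pow_zero, div_one]
      have : γ / (2 * n * C) < ‖intCast q‖ := by linarith
      rw [div_lt_iff₀ (by positivity)] at this
      linarith
    · have := Nat.find_min hex (Nat.sub_one_lt h0.ne')
      rw [Nat.sub_add_cancel (show 1 ≤ Nat.find hex from h0)] at this
      exact not_le.1 this
  generalize Nat.find hex = k at hk hlt
  obtain ⟨j, hj, hjd⟩ := hA k
  have htr := le_norm_affForm_of_dual (A := A) (hb j) q p
  have hθk : 0 < θ ^ k := by positivity
  have hRpos : 0 < R := by linarith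
  have hq1 : γ / (2 * n * C) * θ ^ k ≤ ‖intCast q‖ := by
    rw [lt_div_iff₀ hθk] at hlt
    rw [div_mul_eq_mul_div, div_le_iff₀ (by positivity)]
    linarith
  have hv1 : γ / (2 * m * R ^ (k₀ + 1)) / R ^ k ≤ ‖affForm A b q p‖ := by
    rw [div_div, mul_assoc, ← pow_add, div_le_iff₀ (by positivity)]
    have h1 : n * ‖intCast q‖ * dualDist A (w j) ≤ γ / 2 := by
      refine le_trans ?_ hk
      rw [mul_div_assoc]
      gcongr
    have h2 : ‖intCast (w j)‖ ≤ R ^ (k₀ + 1 + k) :=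
      (hw j).le.trans (pow_le_pow_right₀ hR.le (by omega))
    have h3 : m * ‖intCast (w j)‖ * ‖affForm A b q p‖ ≤
        m * R ^ (k₀ + 1 + k) * ‖affForm A b q p‖ := by gcongr
    linarith
  calc (γ / (2 * m * R ^ (k₀ + 1))) ^ m * (γ / (2 * n * C)) ^ n
      = (γ / (2 * m * R ^ (k₀ + 1)) / R ^ k) ^ m * (γ / (2 * n * C) * θ ^ k) ^ n := by
        have : (θ ^ k) ^ n = (R ^ k) ^ m := by
          rw [← pow_mul, mul_comm, pow_mul, h, ← pow_mul, ← pow_mul, mul_comm]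
        rw [mul_pow _ (θ ^ k), this, div_pow _ (R ^ k)]
        field_simp
    _ ≤ ‖affForm A b q p‖ ^ m * ‖intCast q‖ ^ n := by gcongr

/-- Every cube contains a cube of comparable size on which a given integral linear form, of
suitable norm, stays away from the integers. -/
theorem exists_subcube_away_from_int {m : ℕ} (hm : 0 < m) (a : Fin m → ℝ) {ρ R : ℝ} (hR : 0 < R)
    (hρ : 0 < ρ) (w : Fin m → ℤ) (h1 : 1 / (4 * R) ≤ ‖intCast w‖ * ρ)
    (h2 : ‖intCast w‖ * ρ ≤ 1 / 4) :
    ∃ a' : Fin m → ℝ, (∀ i, a i ≤ a' i ∧ a' i + ρ / (8 * m) ≤ a i + ρ) ∧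
      ∀ b : Fin m → ℝ, (∀ i, a' i ≤ b i ∧ b i ≤ a' i + ρ / (8 * m)) →
        ∀ p : ℤ, 1 / (16 * R) ≤ |∑ i, b i * (w i : ℝ) + p| := by
  have hm1 : (1 : ℝ) ≤ m := by exact_mod_cast hm
  have : Nonempty (Fin m) := ⟨⟨0, hm⟩⟩
  obtain ⟨i₀, hi₀⟩ : ∃ i, ‖intCast w‖ = |(w i : ℝ)| := by
    obtain ⟨i, hi⟩ := Finite.exists_max fun i => |(w i : ℝ)|
    exact ⟨i, le_antisymm ((norm_intCast_le_iff (abs_nonneg _)).2 hi)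
      (norm_le_pi_norm (intCast w) i)⟩
  set t := ‖intCast w‖ * ρ with ht
  have hκ : ρ / (8 * m) ≤ ρ / 8 := by
    gcongr
    linarith
  have hκ0 : 0 < ρ / (8 * m) := by positivity
  have hR4 : 1 / (16 * R) ≤ t / 4 := by
    have : 1 / (16 * R) = 1 / (4 * R) / 4 := by
      field_simp
      norm_num
    linarith
  have htpos : 0 < t := lt_of_lt_of_le (by positivity) h1
  have hvar : ∀ a' b : Fin m → ℝ, (∀ i, a' i ≤ b i ∧ b i ≤ a' i + ρ / (8 * m)) →
      |∑ i, b i * (w i : ℝ) - ∑ i, a' i * (w i : ℝ)| ≤ t / 8 := by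
    intro a' b hb
    rw [← Finset.sum_sub_distrib]
    refine (Finset.abs_sum_le_sum_abs _ _).trans ((Finset.sum_le_card_nsmul _ _
      (ρ / (8 * m) * ‖intCast w‖) fun i _ => ?_).trans ?_)
    · rw [← sub_mul, abs_mul]
      refine mul_le_mul ?_ (norm_le_pi_norm (intCast w) i) (abs_nonneg _) hκ0.le
      rw [abs_of_nonneg (by linarith [(hb i).1])]
      linarith [(hb i).2]
    · simp only [Finset.card_univ, Fintype.card_fin, nsmul_eq_mul, ht]
      apply le_of_eq
      field_simp
  let a₂ : Fin m → ℝ := fun i => a i + if i = i₀ then ρ - ρ / (8 * m) else 0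
  have hdiff : ∑ i, a₂ i * (w i : ℝ) - ∑ i, a i * (w i : ℝ) = (ρ - ρ / (8 * m)) * w i₀ := by
    rw [← Finset.sum_sub_distrib]
    simp only [a₂, ← sub_mul, add_sub_cancel_left, ite_mul, zero_mul]
    simp
  have hD : |(ρ - ρ / (8 * m)) * (w i₀ : ℝ)| = (ρ - ρ / (8 * m)) * ‖intCast w‖ := by
    rw [abs_mul, ← hi₀, abs_of_nonneg (by linarith)]
  have hw0 : 0 ≤ ‖intCast w‖ := norm_nonneg _
  have hD1 : 7 / 8 * t ≤ |(ρ - ρ / (8 * m)) * (w i₀ : ℝ)| := by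
    rw [hD, ht]
    nlinarith
  have hD2 : |(ρ - ρ / (8 * m)) * (w i₀ : ℝ)| ≤ t := by
    rw [hD, ht]
    nlinarith
  by_contra hcon
  push Not at hcon
  obtain ⟨b₁, hb₁, p₁, hp₁⟩ := hcon a fun i => ⟨le_rfl, by linarith⟩
  obtain ⟨b₂, hb₂, p₂, hp₂⟩ := hcon a₂ fun i => by
    simp only [a₂]
    split_ifs <;> constructor <;> linarith
  have v₁ := abs_le.1 (hvar _ _ hb₁)
  have v₂ := abs_le.1 (hvar _ _ hb₂)
  have u₁ := abs_lt.1 hp₁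
  have u₂ := abs_lt.1 hp₂
  have d2 := abs_le.1 hD2
  have hp : p₁ = p₂ := by
    have hlt : |((p₁ - p₂ : ℤ) : ℝ)| < 1 := by
      push_cast
      rw [abs_lt]
      constructor <;> linarith
    have : |p₁ - p₂| < 1 := by exact_mod_cast hlt
    have := Int.abs_lt_one_iff.1 this
    omega
  subst hp
  have : |(ρ - ρ / (8 * m)) * (w i₀ : ℝ)| < 7 / 8 * t := by
    rw [abs_lt]
    constructor <;> linarith
  linarith

/-- The corners of the nested cubes, of side lengths `ρ k`, that are selected by a sequence of
digits; the map `shift` moves the corner of a cube to the corner of a subcube. -/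
def nestedCorner {m N : ℕ} (shift : ℕ → (Fin m → ℝ) → Fin m → ℝ) (ρ : ℕ → ℝ) (a : Fin m → ℝ)
    (D : ℕ → Fin m → Fin N) : ℕ → Fin m → ℝ
  | 0 => a
  | k + 1 => fun i =>
      shift k (nestedCorner shift ρ a D k) i + 2 * ρ (k + 1) * ((D k i : ℕ) : ℝ)

theorem nestedCorner_congr {m N : ℕ} (shift : ℕ → (Fin m → ℝ) → Fin m → ℝ) (ρ : ℕ → ℝ)
    (a : Fin m → ℝ) {D D' : ℕ → Fin m → Fin N} {k : ℕ} (h : ∀ l < k, D l = D' l) :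
    nestedCorner shift ρ a D k = nestedCorner shift ρ a D' k := by
  induction k with
  | zero => rfl
  | succ k ih =>
    rw [nestedCorner, nestedCorner, ih fun l hl => h l (by omega), h k (by omega)]

/-- A Cantor set, parametrized by sequences of digits, of points on which a lacunary sequence of
integral linear forms stays away from the integers. -/
theorem exists_cantor_param {m N : ℕ} (hm : 0 < m) (a : Fin m → ℝ) {ρ : ℕ → ℝ} {R : ℝ}
    (hR : 0 < R) (hρ : ∀ k, 0 < ρ k) (hρN : ∀ k, ρ (k + 1) * (16 * m * N) = ρ k)
    {w : ℕ → Fin m → ℤ} (h1 : ∀ k, 1 / (4 * R) ≤ ‖intCast (w k)‖ * ρ k)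
    (h2 : ∀ k, ‖intCast (w k)‖ * ρ k ≤ 1 / 4) :
    ∃ g : (ℕ → Fin m → Fin N) → Fin m → ℝ,
      (∀ D i, a i ≤ g D i ∧ g D i ≤ a i + ρ 0) ∧
      (∀ D k, ∀ p : ℤ, 1 / (16 * R) ≤ |∑ i, g D i * (w k i : ℝ) + p|) ∧
      ∀ D D' k, (∀ l < k, D l = D' l) → D k ≠ D' k → ρ (k + 1) ≤ ‖g D - g D'‖ := by
  choose shift hs1 hs2 using fun k a' => exists_subcube_away_from_int hm a' hR (hρ k) (w k)
    (h1 k) (h2 k)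
  have hm1 : (1 : ℝ) ≤ m := by exact_mod_cast hm
  let c := nestedCorner (N := N) shift ρ a
  have hlow : ∀ D k i, shift k (c D k) i ≤ c D (k + 1) i := by
    intro D k i
    have : 0 ≤ 2 * ρ (k + 1) * ((D k i : ℕ) : ℝ) :=
      mul_nonneg (by linarith [hρ (k + 1)]) (Nat.cast_nonneg _)
    simp only [c, nestedCorner]
    linarith
  have hupp : ∀ D k i, c D (k + 1) i + ρ (k + 1) ≤ shift k (c D k) i + ρ k / (8 * m) := by
    intro D k i
    have hd : ((D k i : ℕ) : ℝ) + 1 ≤ N := by exact_mod_cast (D k i).2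
    have e : ρ k / (8 * m) = 2 * ρ (k + 1) * N := by
      rw [← hρN k]
      field_simp
      ring
    rw [e]
    simp only [c, nestedCorner]
    nlinarith [hρ (k + 1)]
  have hmono : ∀ D i, Monotone fun k => c D k i := fun D i =>
    monotone_nat_of_le_succ fun k => (hs1 k (c D k) i).1.trans (hlow D k i)
  have hanti : ∀ D i, Antitone fun k => c D k i + ρ k := fun D i =>
    antitone_nat_of_succ_le fun k => (hupp D k i).trans (hs1 k (c D k) i).2
  have hcc : ∀ D i k l, c D k i ≤ c D l i + ρ l := by
    intro D i k l
    have h3 := hmono D i (le_max_left k l)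
    have h4 := hanti D i (le_max_right k l)
    have h5 := hρ (max k l)
    simp only at h3 h4
    linarith
  let g : (ℕ → Fin m → Fin N) → Fin m → ℝ := fun D i => ⨆ k, c D k i
  have hg1 : ∀ D k i, c D k i ≤ g D i := fun D k i =>
    le_ciSup (f := fun k => c D k i) ⟨c D 0 i + ρ 0, by
      rintro _ ⟨l, rfl⟩
      exact hcc D i l 0⟩ k
  have hg2 : ∀ D k i, g D i ≤ c D k i + ρ k := fun D k i => ciSup_le fun l => hcc D i l k
  refine ⟨g, fun D i => ⟨hg1 D 0 i, hg2 D 0 i⟩, fun D k => ?_, fun D D' k hl hk => ?_⟩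
  · exact hs2 k (c D k) (g D) fun i =>
      ⟨(hlow D k i).trans (hg1 D (k + 1) i), (hg2 D (k + 1) i).trans (hupp D k i)⟩
  · obtain ⟨i, hi⟩ := Function.ne_iff.1 hk
    refine le_trans ?_ (norm_le_pi_norm (g D - g D') i)
    have hc : c D k = c D' k := nestedCorner_congr shift ρ a hl
    have e1 : c D (k + 1) i = shift k (c D k) i + 2 * ρ (k + 1) * ((D k i : ℕ) : ℝ) := rfl
    have e2 : c D' (k + 1) i = shift k (c D k) i + 2 * ρ (k + 1) * ((D' k i : ℕ) : ℝ) := by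
      rw [hc]
      rfl
    have hpos := hρ (k + 1)
    have a1 := hg1 D (k + 1) i
    have a2 := hg2 D (k + 1) i
    have a3 := hg1 D' (k + 1) i
    have a4 := hg2 D' (k + 1) i
    rw [Pi.sub_apply, Real.norm_eq_abs, le_abs]
    rcases lt_or_gt_of_ne (Fin.val_ne_of_ne hi) with hlt | hlt
    · right
      have : ((D k i : ℕ) : ℝ) + 1 ≤ ((D' k i : ℕ) : ℝ) := by exact_mod_cast hlt
      nlinarith
    · left
      have : ((D' k i : ℕ) : ℝ) + 1 ≤ ((D k i : ℕ) : ℝ) := by exact_mod_cast hlt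
      nlinarith

theorem exists_nat_rpow_mul_le {r c : ℝ} (hr : r < 1) (hc : 0 ≤ c) :
    ∃ N : ℕ, 2 ≤ N ∧ (c * N) ^ r ≤ N := by
  have h := ((tendsto_rpow_atTop (sub_pos.2 hr)).comp
    tendsto_natCast_atTop_atTop).eventually_ge_atTop (c ^ r)
  obtain ⟨N, hN, hN2⟩ := (h.and (eventually_ge_atTop 2)).exists
  refine ⟨N, hN2, ?_⟩
  have hN0 : (0 : ℝ) < N := by exact_mod_cast (by omega : 0 < N)
  calc (c * N) ^ r = c ^ r * (N : ℝ) ^ r := Real.mul_rpow hc hN0.le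
    _ ≤ (N : ℝ) ^ (1 - r) * (N : ℝ) ^ r := by
        gcongr
        exact hN
    _ = N := by rw [← Real.rpow_add hN0, sub_add_cancel, Real.rpow_one]

/-- For every matrix `A`, the set of `b` for which `⟨A, b⟩` is badly approximable is thick. -/
theorem le_dimH_badly_approximable_slice {m n : ℕ} (hm : 0 < m) (hn : 0 < n)
    (A : Fin m → Fin n → ℝ) {V : Set (Fin m → ℝ)} (hV : IsOpen V) (hVne : V.Nonempty) :
    (m : ℝ≥0∞) ≤ dimH (V ∩ {b | IsBadlyApproximable A b}) := by
  suffices H : ∀ r : ℝ≥0, 0 < r → r < 1 →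
      (r : ℝ≥0∞) * m ≤ dimH (V ∩ {b | IsBadlyApproximable A b}) by
    refine ENNReal.le_of_forall_nnreal_lt fun r hr => ?_
    rcases eq_zero_or_pos r with rfl | hr0
    · simp
    have hm' : (0 : ℝ≥0) < m := by exact_mod_cast hm
    have hrm : r < m := by exact_mod_cast hr
    refine le_trans (le_of_eq ?_) (H (r / m) (div_pos hr0 hm') ((div_lt_one hm').2 hrm))
    rw [← ENNReal.coe_natCast, ← ENNReal.coe_mul, div_mul_cancel₀ _ hm'.ne']
  intro r hr0 hr1
  obtain ⟨N, hN2, hNr⟩ := exists_nat_rpow_mul_le (r := r) (c := 16 * m) (by exact_mod_cast hr1)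
    (by positivity)
  set R : ℕ := 16 * m * N with hRdef
  have hRN : N ≤ R := by
    rw [hRdef]
    exact Nat.le_mul_of_pos_left _ (by omega)
  have hR2 : 2 ≤ R := hN2.trans hRN
  have hRr : (1 : ℝ) < R := by exact_mod_cast (by omega : 1 < R)
  have hR0 : (0 : ℝ) < R := by linarith
  have hN0 : (0 : ℝ) < N := by exact_mod_cast (by omega : 0 < N)
  have hRr' : (R : ℝ) ^ (r : ℝ) ≤ N := by
    rw [hRdef]
    push_cast
    exact hNr
  obtain ⟨b₀, hb₀⟩ := hVne
  obtain ⟨ε, hε, hball⟩ := Metric.isOpen_iff.1 hV b₀ hb₀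
  obtain ⟨k₀, hk₀⟩ := pow_unbounded_of_one_lt (1 / ε) hRr
  have hθn : ((R : ℝ) ^ ((m : ℝ) / n)) ^ n = (R : ℝ) ^ m := by
    rw [← Real.rpow_natCast, ← Real.rpow_mul hR0.le, div_mul_cancel₀ _ (by positivity),
      Real.rpow_natCast]
  have hθ : 1 < (R : ℝ) ^ ((m : ℝ) / n) := Real.one_lt_rpow hRr (by positivity)
  obtain ⟨w, hw, hwA⟩ := exists_lacunary A hm hn hR2 k₀ hθ hθn
  let ρ : ℕ → ℝ := fun k => 1 / (4 * R ^ (k₀ + k + 1))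
  obtain ⟨g, hg1, hg2, hg3⟩ := exists_cantor_param (N := N) hm b₀ (ρ := ρ) hR0
    (fun k => by positivity)
    (fun k => by
      have : (16 * m * N : ℝ) = R := by
        rw [hRdef]
        push_cast
        ring
      rw [this]
      simp only [ρ]
      rw [← add_assoc k₀ k 1, pow_succ _ (k₀ + k + 1)]
      field_simp)
    (w := w)
    (fun k => by
      have := (hw k).1
      simp only [ρ]
      rw [mul_one_div, div_le_div_iff₀ (by positivity) (by positivity), pow_succ]
      nlinarith)
    (fun k => by
      have := (hw k).2
      simp only [ρ]
      rw [mul_one_div, div_le_div_iff₀ (by positivity) (by positivity)]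
      nlinarith)
  have : NeZero N := ⟨by omega⟩
  let dig : (Fin m → ℝ) → ℕ → Fin m → Fin N := fun x k i => Real.digits (x i) N k
  let S : Set (Fin m → ℝ) := Set.pi Set.univ fun _ => Set.Ico 0 1
  have hS : dimH S = m := by
    have : S ∈ 𝓝 (fun _ : Fin m => (1 / 2 : ℝ)) :=
      set_pi_mem_nhds Set.finite_univ fun i _ => Ico_mem_nhds (by norm_num) (by norm_num)
    rw [Real.dimH_of_mem_nhds this, Module.finrank_fin_fun]
  have hdig : ∀ x ∈ S, ∀ i, Real.ofDigits (fun k => dig x k i) = x i := fun x hx i =>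
    Real.ofDigits_digits (by omega) (hx i trivial)
  let C : ℝ := (4 * R ^ (k₀ + 2)) ^ (r : ℝ)
  have hC0 : 0 ≤ C := by positivity
  have hdist : ∀ x ∈ S, ∀ y ∈ S, dist x y ≤ C * dist (g (dig x)) (g (dig y)) ^ (r : ℝ) := by
    intro x hx y hy
    by_cases hxy : dig x = dig y
    · have : x = y := by
        ext i
        rw [← hdig x hx i, ← hdig y hy i, hxy]
      rw [this, dist_self]
      positivity
    have hex := Function.ne_iff.1 hxy
    have hk := Nat.find_spec hex
    have hlt : ∀ l < Nat.find hex, dig x l = dig y l := fun l hl =>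
      not_not.1 (Nat.find_min hex hl)
    generalize Nat.find hex = k at hk hlt
    have h1 : dist x y ≤ ((N : ℝ) ^ k)⁻¹ := by
      refine (dist_pi_le_iff (by positivity)).2 fun i => ?_
      rw [← hdig x hx i, ← hdig y hy i, Real.dist_eq]
      exact Real.abs_ofDigits_sub_ofDigits_le fun l hl => congrFun (hlt l hl) i
    have h2 : ρ (k + 1) ≤ dist (g (dig x)) (g (dig y)) := by
      rw [dist_eq_norm]
      exact hg3 _ _ k hlt hk
    calc dist x y ≤ ((N : ℝ) ^ k)⁻¹ := h1
      _ ≤ (((R : ℝ) ^ (r : ℝ)) ^ k)⁻¹ := by gcongr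
      _ = C * ρ (k + 1) ^ (r : ℝ) := by
          simp only [C, ρ]
          rw [← Real.mul_rpow (by positivity) (by positivity), ← Real.rpow_natCast,
            ← Real.rpow_mul hR0.le, mul_comm, Real.rpow_mul hR0.le, Real.rpow_natCast,
            ← Real.inv_rpow (by positivity)]
          congr 1
          rw [show k₀ + (k + 1) + 1 = (k₀ + 2) + k by ring, pow_add _ _ k]
          field_simp
      _ ≤ C * dist (g (dig x)) (g (dig y)) ^ (r : ℝ) := by
          have : 0 ≤ ρ (k + 1) := by positivity
          gcongr
  have hdim := le_dimH_image_of_edist_le (C := C.toNNReal) (r := r) (s := S)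
    (h := fun x => g (dig x)) hr0 fun x hx y hy => by
      change _ ≤ ENNReal.ofReal C * _
      rw [edist_dist, edist_dist, ENNReal.ofReal_rpow_of_nonneg dist_nonneg r.coe_nonneg,
        ← ENNReal.ofReal_mul hC0]
      exact ENNReal.ofReal_le_ofReal (hdist x hx y hy)
  rw [hS] at hdim
  refine hdim.trans (dimH_mono ?_)
  rintro _ ⟨x, -, rfl⟩
  refine ⟨hball ?_, ?_⟩
  · have hρε : ρ 0 < ε := by
      rw [div_lt_iff₀ hε] at hk₀
      simp only [ρ, add_zero]
      rw [div_lt_iff₀ (by positivity), pow_succ]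
      have : 0 < (R : ℝ) ^ k₀ := by positivity
      nlinarith [mul_pos this hε]
    refine (dist_pi_lt_iff hε).2 fun i => ?_
    have := hg1 (dig x) i
    rw [Real.dist_eq, abs_of_nonneg (by linarith [this.1])]
    linarith [this.2]
  · exact isBadlyApproximable_of_dual hm hn hRr hθ hθn (C := 2 * (R : ℝ) ^ k₀) (by positivity)
      (γ := 1 / (16 * R)) (by positivity) (fun j => (hw j).2) hwA (hg2 (dig x))

/-- The set of badly approximable systems of affine forms is thick in
`M_{m,n}(ℝ) × ℝ^m`. -/
theorem badly_approximable_affine_thick (m n : ℕ) (hm : 0 < m) (hn : 0 < n)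
    (W : Set ((Fin m → Fin n → ℝ) × (Fin m → ℝ))) (hWopen : IsOpen W)
    (hWne : W.Nonempty) :
    dimH (W ∩ {x | IsBadlyApproximable x.1 x.2}) = (m * n + m : ℕ) := by
  apply le_antisymm
  · refine (dimH_mono (Set.subset_univ _)).trans (le_of_eq ?_)
    rw [Real.dimH_univ_eq_finrank, Module.finrank_prod, Module.finrank_pi_fintype]
    simp
  · obtain ⟨⟨A₀, b₀⟩, h₀⟩ := hWne
    obtain ⟨U, V, hU, hV, hA₀, hb₀, hUV⟩ := isOpen_prod_iff.1 hWopen A₀ b₀ h₀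
    set E := W ∩ {x | IsBadlyApproximable x.1 x.2}
    have H : ∀ s : ℝ≥0, 0 < s → s < m → ((m * n : ℕ) : ℝ≥0∞) + s ≤ dimH E := by
      intro s hs hsm
      suffices Measure.hausdorffMeasure (((m * n : ℕ) + s : ℝ≥0) : ℝ) E ≠ 0 by
        exact_mod_cast le_dimH_of_hausdorffMeasure_ne_zero this
      intro hE
      have hae := ae_hausdorffMeasure_slice_eq_zero (μ := volume) (d := ((m * n : ℕ) : ℝ))
        (s := s) (Nat.cast_nonneg _) (by exact_mod_cast hs) volume_matrix_le_ediam_pow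
        (E := E) (by exact_mod_cast hE)
      obtain ⟨A, hAU, hA⟩ : ∃ A ∈ U, Measure.hausdorffMeasure (s : ℝ) {b | (A, b) ∈ E} = 0 := by
        by_contra hcon
        push Not at hcon
        refine (hU.measure_pos volume ⟨A₀, hA₀⟩).ne' (measure_mono_null ?_ (ae_iff.1 hae))
        exact hcon
      have hle : (m : ℝ≥0∞) ≤ dimH {b | (A, b) ∈ E} :=
        (le_dimH_badly_approximable_slice hm hn A hV ⟨b₀, hb₀⟩).trans
          (dimH_mono fun b hb => ⟨hUV ⟨hAU, hb.1⟩, hb.2⟩)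
      have htop := hausdorffMeasure_of_lt_dimH (lt_of_lt_of_le
        (by exact_mod_cast hsm : (s : ℝ≥0∞) < m) hle)
      rw [hA] at htop
      exact ENNReal.zero_ne_top htop
    refine ENNReal.le_of_forall_nnreal_lt fun t ht => ?_
    have ht' : t < (m * n : ℕ) + (m : ℝ≥0) := by exact_mod_cast ht
    have hm' : (0 : ℝ≥0) < m := by exact_mod_cast hm
    have hlt : t - (m * n : ℕ) < (m : ℝ≥0) := by
      rcases le_total t (m * n : ℕ) with h | h
      · rwa [tsub_eq_zero_of_le h]
      · exact (tsub_lt_iff_left h).2 ht'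
    obtain ⟨s, hs1, hs2⟩ := exists_between hlt
    refine le_trans ?_ (H s (bot_le.trans_lt hs1) hs2)
    have : t ≤ (m * n : ℕ) + s := tsub_le_iff_left.1 hs1.le
    exact_mod_cast this
end
end

section
/- Let m, n be positive integers. The set of badly approximable systems of affine forms ⟨A,b⟩ has Lebesgue measure zero in M_{m,n}(ℝ) × ℝ^m (identified with ℝ^{mn+m}). -/
open MeasureTheory Filter

noncomputable section

open ProbabilityTheory in
/-- A second-moment bound: if the events `E i` are pairwise independent and the expected number of
them that occur is large, then the probability that none occurs is small. -/
theorem measureReal_iInter_compl_mul_sum_le_one {Ω ι : Type*} [MeasurableSpace Ω] {μ : Measure Ω}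
    [IsProbabilityMeasure μ] {F : Finset ι} {E : ι → Set Ω} (hE : ∀ i, MeasurableSet (E i))
    (hind : (F : Set ι).Pairwise fun i j =>
      IndepFun ((E i).indicator (1 : Ω → ℝ)) ((E j).indicator (1 : Ω → ℝ)) μ) :
    μ.real (⋂ i ∈ F, (E i)ᶜ) * ∑ i ∈ F, μ.real (E i) ≤ 1 := by
  set s := ∑ i ∈ F, μ.real (E i) with hs
  set X : ι → Ω → ℝ := fun i => (E i).indicator 1 with hX
  have hs0 : 0 ≤ s := Finset.sum_nonneg fun i _ => measureReal_nonneg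
  rcases hs0.eq_or_lt with h0 | hpos
  · rw [← h0]; simp
  have hmem : ∀ i, MemLp (X i) 2 μ := fun i =>
    memLp_indicator_const 2 (hE i) (1 : ℝ) (Or.inr (measure_ne_top _ _))
  have hint : ∀ i, ∫ ω, X i ω ∂μ = μ.real (E i) := fun i => integral_indicator_one (hE i)
  have hsum : ∫ ω, (∑ i ∈ F, X i) ω ∂μ = s := by
    simp_rw [Finset.sum_apply]
    rw [integral_finsetSum _ fun i _ => (hmem i).integrable one_le_two]
    exact Finset.sum_congr rfl fun i _ => hint i
  have hvar : variance (∑ i ∈ F, X i) μ ≤ s := by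
    rw [IndepFun.variance_sum (fun i _ => hmem i) hind]
    refine Finset.sum_le_sum fun i _ => ?_
    refine (variance_le_expectation_sq (hmem i).1).trans_eq ?_
    rw [← hint i]
    congr 1
    ext ω
    by_cases h : ω ∈ E i <;> simp [hX, h]
  have hcheb := meas_ge_le_variance_div_sq (memLp_finsetSum' F fun i _ => hmem i) hpos
  rw [hsum] at hcheb
  have hsub : (⋂ i ∈ F, (E i)ᶜ) ⊆ {ω | s ≤ |(∑ i ∈ F, X i) ω - s|} := by
    intro ω hω
    simp only [Set.mem_iInter, Set.mem_compl_iff] at hω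
    have : (∑ i ∈ F, X i) ω = 0 := by
      rw [Finset.sum_apply]
      exact Finset.sum_eq_zero fun i hi => Set.indicator_of_notMem (hω i hi) _
    rw [Set.mem_ofPred_eq, this, zero_sub, abs_neg]
    exact le_abs_self s
  have h1 : μ.real (⋂ i ∈ F, (E i)ᶜ) ≤ variance (∑ i ∈ F, X i) μ / s ^ 2 :=
    ENNReal.toReal_le_of_le_ofReal (div_nonneg (variance_nonneg _ _) (sq_nonneg _))
      ((measure_mono hsub).trans hcheb)
  calc μ.real (⋂ i ∈ F, (E i)ᶜ) * s ≤ s / s ^ 2 * s := by gcongr; exact h1.trans (by gcongr)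
    _ = 1 := by field_simp

instance : IsProbabilityMeasure (volume : Measure UnitAddCircle) :=
  ⟨UnitAddCircle.measure_univ⟩

instance : SecondCountableTopology UnitAddCircle :=
  QuotientAddGroup.instSecondCountableTopology _

instance {m n : ℕ} : Measure.IsAddHaarMeasure
    (volume : Measure (Fin m → Fin n → UnitAddCircle)) :=
  Measure.pi.isAddHaarMeasure fun _ : Fin m => (volume : Measure (Fin n → UnitAddCircle))

instance {m n : ℕ} : Measure.IsAddHaarMeasure
    (volume : Measure ((Fin m → Fin n → UnitAddCircle) × (Fin m → UnitAddCircle))) :=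
  Measure.prod.instIsAddHaarMeasure _ _

instance {m : ℕ} : Measure.IsAddHaarMeasure
    (volume : Measure ((Fin m → UnitAddCircle) × (Fin m → UnitAddCircle))) :=
  Measure.prod.instIsAddHaarMeasure _ _

/-- The system of affine forms at `q`, with coefficients and values taken modulo `1`. -/
def torusForm {m n : ℕ} (q : Fin n → ℤ) :
    (Fin m → Fin n → UnitAddCircle) × (Fin m → UnitAddCircle) →+ (Fin m → UnitAddCircle) where
  toFun x i := (∑ j, q j • x.1 i j) + x.2 i
  map_zero' := by ext; simp
  map_add' x y := by
    ext i
    simp only [Prod.fst_add, Prod.snd_add, Pi.add_apply, smul_add, Finset.sum_add_distrib]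
    abel

theorem torusForm_apply {m n : ℕ} (q : Fin n → ℤ)
    (x : (Fin m → Fin n → UnitAddCircle) × (Fin m → UnitAddCircle)) (i : Fin m) :
    torusForm q x i = (∑ j, q j • x.1 i j) + x.2 i := rfl

theorem continuous_torusForm {m n : ℕ} (q : Fin n → ℤ) :
    Continuous (torusForm (m := m) q) := by
  change Continuous fun x : (Fin m → Fin n → UnitAddCircle) × (Fin m → UnitAddCircle) =>
    fun i => (∑ j, q j • x.1 i j) + x.2 i
  fun_prop

theorem measurePreserving_torusForm {m n : ℕ} (q : Fin n → ℤ) :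
    MeasurePreserving (torusForm (m := m) q) := by
  refine AddMonoidHom.measurePreserving (continuous_torusForm q) (fun u => ⟨(0, u), ?_⟩) (by simp)
  ext i
  simp [torusForm_apply]

theorem surjective_torusForm_prod {m n : ℕ} {q q' : Fin n → ℤ} (h : q ≠ q') :
    Function.Surjective ((torusForm (m := m) q).prod (torusForm q')) := by
  rintro ⟨u, v⟩
  obtain ⟨j, hj⟩ := Function.ne_iff.1 h
  set a : Fin m → UnitAddCircle := fun i => DivisibleBy.div (u i - v i) (q j - q' j)
  have ha : ∀ i, (q j - q' j) • a i = u i - v i := fun i =>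
    DivisibleBy.div_cancel _ (sub_ne_zero.2 hj)
  have hsum : ∀ (r : Fin n → ℤ) (i : Fin m),
      ∑ l, r l • (Pi.single j (a i) : Fin n → UnitAddCircle) l = r j • a i := fun r i => by
    rw [Finset.sum_eq_single j] <;> simp +contextual
  refine ⟨(fun i => Pi.single j (a i), fun i => u i - q j • a i), ?_⟩
  ext i
  · simp [torusForm_apply, hsum]
  · have := ha i
    rw [sub_smul] at this
    simp only [AddMonoidHom.prod_apply, torusForm_apply, hsum]
    rw [add_comm, sub_add, this, sub_sub_cancel]

theorem indepFun_torusForm {m n : ℕ} {q q' : Fin n → ℤ} (h : q ≠ q') :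
    ProbabilityTheory.IndepFun (torusForm (m := m) q) (torusForm q') volume := by
  have hp : MeasurePreserving ((torusForm (m := m) q).prod (torusForm q')) :=
    AddMonoidHom.measurePreserving
      ((continuous_torusForm q).prodMk (continuous_torusForm q'))
      (surjective_torusForm_prod h) (by simp)
  rw [ProbabilityTheory.indepFun_iff_map_prod_eq_prod_map_map
    (continuous_torusForm q).measurable.aemeasurable
    (continuous_torusForm q').measurable.aemeasurable,
    (measurePreserving_torusForm q).map_eq, (measurePreserving_torusForm q').map_eq]
  exact hp.map_eq

theorem pow_le_volume_closedBall {m : ℕ} {r : ℝ} (h0 : 0 ≤ r) (h1 : r ≤ 1) :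
    r ^ m ≤ volume.real (Metric.closedBall (0 : Fin m → UnitAddCircle) r) := by
  rw [closedBall_pi _ h0, volume_pi, measureReal_def, Measure.pi_pi, ENNReal.toReal_prod]
  simp only [AddCircle.volume_closedBall]
  rw [Finset.prod_const, Finset.card_univ, Fintype.card_fin]
  gcongr
  rw [ENNReal.toReal_ofReal (by positivity)]
  exact le_min h1 (by linarith)

/-- Integer vectors whose first coordinate is `k` and whose other coordinates lie in `[0, k)`. -/
def shell (n k : ℕ) : Finset (Fin (n + 1) → ℤ) :=
  Fintype.piFinset fun j => if j = 0 then {(k : ℤ)} else Finset.Ico 0 (k : ℤ)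

theorem apply_zero_of_mem_shell {n k : ℕ} {q : Fin (n + 1) → ℤ} (hq : q ∈ shell n k) :
    q 0 = k := by
  simpa using Fintype.mem_piFinset.1 hq 0

theorem card_shell (n k : ℕ) : (shell n k).card = k ^ n := by
  simp [shell, Fin.prod_univ_succ]

theorem norm_intCast_of_mem_shell {n k : ℕ} {q : Fin (n + 1) → ℤ} (hq : q ∈ shell n k) :
    ‖intCast q‖ = k := by
  apply le_antisymm
  · rw [pi_norm_le_iff_of_nonneg k.cast_nonneg]
    intro j
    have hj := Fintype.mem_piFinset.1 hq j
    have : |q j| ≤ k := by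
      split_ifs at hj
      · rw [Finset.mem_singleton.1 hj]; simp
      · rw [Finset.mem_Ico] at hj
        rw [abs_of_nonneg hj.1]
        exact hj.2.le
    rw [intCast, Real.norm_eq_abs]
    exact_mod_cast this
  · simpa [intCast, apply_zero_of_mem_shell hq] using norm_le_pi_norm (intCast q) 0

/-- Systems modulo `1` that miss every target of radius `r k` along the shells beyond `T`. -/
def torusBad (m n T : ℕ) (r : ℕ → ℝ) :
    Set ((Fin m → Fin (n + 1) → UnitAddCircle) × (Fin m → UnitAddCircle)) :=
  {x | ∀ k, T ≤ k → ∀ q ∈ shell n k, r k < ‖torusForm q x‖}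

theorem volume_torusBad {m n T : ℕ} {r : ℕ → ℝ} {c : ℝ} (hT : 0 < T) (hc : 0 < c)
    (h0 : ∀ k, 0 ≤ r k) (h1 : ∀ k, T ≤ k → r k ≤ 1)
    (hr : ∀ k, T ≤ k → c / (k : ℝ) ^ (n + 1) ≤ r k ^ m) :
    volume (torusBad m n T r) = 0 := by
  set E : (Fin (n + 1) → ℤ) →
      Set ((Fin m → Fin (n + 1) → UnitAddCircle) × (Fin m → UnitAddCircle)) :=
    fun q => torusForm q ⁻¹' Metric.closedBall 0 (r (q 0).toNat) with hE
  have hmeas : ∀ q, MeasurableSet (E q) := fun q =>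
    (continuous_torusForm q).measurable Metric.isClosed_closedBall.measurableSet
  have key : ∀ N : ℕ,
      volume.real (torusBad m n T r) * (c * ∑ k ∈ Finset.Ico T N, 1 / (k : ℝ)) ≤ 1 := by
    intro N
    set F := (Finset.Ico T N).biUnion (shell n) with hF
    have hdisj : ((Finset.Ico T N : Finset ℕ) : Set ℕ).PairwiseDisjoint (shell n) := by
      intro k _ l _ hkl
      rw [Function.onFun, Finset.disjoint_left]
      intro q hq hq'
      exact hkl (by exact_mod_cast
        (apply_zero_of_mem_shell hq).symm.trans (apply_zero_of_mem_shell hq'))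
    have hind : (F : Set (Fin (n + 1) → ℤ)).Pairwise fun q q' =>
        ProbabilityTheory.IndepFun ((E q).indicator
          (1 : (Fin m → Fin (n + 1) → UnitAddCircle) × (Fin m → UnitAddCircle) → ℝ))
          ((E q').indicator
          (1 : (Fin m → Fin (n + 1) → UnitAddCircle) × (Fin m → UnitAddCircle) → ℝ)) volume := by
      intro q _ q' _ hqq
      have hi : ∀ p : Fin (n + 1) → ℤ, Measurable
          ((Metric.closedBall (0 : Fin m → UnitAddCircle) (r (p 0).toNat)).indicator
            (1 : (Fin m → UnitAddCircle) → ℝ)) := fun p =>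
        measurable_one.indicator Metric.isClosed_closedBall.measurableSet
      exact (indepFun_torusForm hqq).comp (hi q) (hi q')
    have hle := measureReal_iInter_compl_mul_sum_le_one hmeas hind
    refine le_trans ?_ hle
    refine mul_le_mul (measureReal_mono ?_) ?_ ?_ measureReal_nonneg
    · intro x hx
      simp only [Set.mem_iInter, hF, Finset.mem_biUnion, Finset.mem_Ico]
      rintro q ⟨k, ⟨hk, -⟩, hq⟩
      have := hx k hk q hq
      simpa [hE, apply_zero_of_mem_shell hq] using this
    · rw [hF, Finset.sum_biUnion hdisj, Finset.mul_sum]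
      refine Finset.sum_le_sum fun k hk => ?_
      have hk := (Finset.mem_Ico.1 hk).1
      have hk0 : (0 : ℝ) < k := by exact_mod_cast hT.trans_le hk
      have : ∀ q ∈ shell n k, c / (k : ℝ) ^ (n + 1) ≤ volume.real (E q) := by
        intro q hq
        rw [hE, (measurePreserving_torusForm q).measureReal_preimage
          Metric.isClosed_closedBall.measurableSet.nullMeasurableSet,
          apply_zero_of_mem_shell hq, Int.toNat_natCast]
        exact (hr k hk).trans (pow_le_volume_closedBall (h0 k) (h1 k hk))
      refine le_trans (le_of_eq ?_) (Finset.card_nsmul_le_sum _ _ _ this)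
      rw [card_shell, nsmul_eq_mul]
      push_cast
      field_simp
      ring
    · exact mul_nonneg hc.le (Finset.sum_nonneg fun k _ => by positivity)
  have htend : Tendsto (fun N => ∑ k ∈ Finset.Ico T N, 1 / (k : ℝ)) atTop atTop := by
    refine tendsto_atTop_mono' _ ?_ ((not_summable_iff_tendsto_nat_atTop_of_nonneg
      (fun k => by positivity)).1 Real.not_summable_one_div_natCast |>.atTop_add
        (tendsto_const_nhds (x := -∑ k ∈ Finset.range T, 1 / (k : ℝ))))
    filter_upwards [eventually_ge_atTop T] with N hN
    rw [Finset.sum_Ico_eq_sub _ hN, sub_eq_add_neg]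
  by_contra hne
  have hpos : 0 < volume.real (torusBad m n T r) :=
    ENNReal.toReal_pos hne (measure_ne_top _ _)
  obtain ⟨N, hN⟩ := (htend.eventually_gt_atTop (1 / (volume.real (torusBad m n T r) * c))).exists
  rw [div_lt_iff₀ (by positivity)] at hN
  nlinarith [key N]

/-- Reduction of a real system of affine forms modulo `1`. -/
def toTorus {m n : ℕ} (x : (Fin m → Fin n → ℝ) × (Fin m → ℝ)) :
    (Fin m → Fin n → UnitAddCircle) × (Fin m → UnitAddCircle) :=
  (fun i j => (x.1 i j : UnitAddCircle), fun i => (x.2 i : UnitAddCircle))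

theorem volume_preimage_toTorus_eq_zero {m n : ℕ}
    {s : Set ((Fin m → Fin n → UnitAddCircle) × (Fin m → UnitAddCircle))} (hs : volume s = 0) :
    volume (toTorus ⁻¹' s) = 0 := by
  set box : (Fin m → Fin n → ℤ) × (Fin m → ℤ) → Set ((Fin m → Fin n → ℝ) × (Fin m → ℝ)) :=
    fun a => (Set.univ.pi fun i => Set.univ.pi fun j => Set.Ioc (a.1 i j : ℝ) (a.1 i j + 1)) ×ˢ
      (Set.univ.pi fun i => Set.Ioc (a.2 i : ℝ) (a.2 i + 1)) with hbox
  have hmp : ∀ a, MeasurePreserving (toTorus (m := m) (n := n)) (volume.restrict (box a)) := by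
    intro a
    have h := (measurePreserving_pi _ _ fun i => measurePreserving_pi _ _ fun j =>
      UnitAddCircle.measurePreserving_mk (a.1 i j : ℝ)).prod
      (measurePreserving_pi _ _ fun i => UnitAddCircle.measurePreserving_mk (a.2 i : ℝ))
    simp_rw [← Measure.restrict_pi_pi] at h
    rw [Measure.prod_restrict] at h
    exact h
  have hcover : toTorus ⁻¹' s ⊆ ⋃ a, toTorus ⁻¹' s ∩ box a := by
    intro x hx
    refine Set.mem_iUnion.2 ⟨(fun i j => ⌈x.1 i j⌉ - 1, fun i => ⌈x.2 i⌉ - 1), hx, ?_⟩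
    have : ∀ t : ℝ, t ∈ Set.Ioc ((⌈t⌉ - 1 : ℤ) : ℝ) ((⌈t⌉ - 1 : ℤ) + 1) := fun t => by
      push_cast
      constructor <;> linarith [Int.ceil_lt_add_one t, Int.le_ceil t]
    exact ⟨fun i _ j _ => this _, fun i _ => this _⟩
  refine measure_mono_null hcover (measure_iUnion_null fun a => ?_)
  have := (hmp a).quasiMeasurePreserving.preimage_null hs
  exact le_antisymm ((Measure.le_restrict_apply _ _).trans this.le) bot_le

theorem exists_norm_affForm_eq {m n : ℕ} (x : (Fin m → Fin n → ℝ) × (Fin m → ℝ))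
    (q : Fin n → ℤ) : ∃ p : Fin m → ℤ, ‖affForm x.1 x.2 q p‖ = ‖torusForm q (toTorus x)‖ := by
  refine ⟨fun i => -round ((∑ j, x.1 i j * (q j : ℝ)) + x.2 i), ?_⟩
  have : ∀ i, ‖torusForm q (toTorus x) i‖ =
      ‖affForm x.1 x.2 q (fun i => -round ((∑ j, x.1 i j * (q j : ℝ)) + x.2 i)) i‖ := by
    intro i
    have h : torusForm q (toTorus x) i =
        (((∑ j, x.1 i j * (q j : ℝ)) + x.2 i : ℝ) : UnitAddCircle) := by
      have hsum := map_sum (QuotientAddGroup.mk' (AddSubgroup.zmultiples (1 : ℝ)))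
        (fun j => x.1 i j * (q j : ℝ)) Finset.univ
      rw [torusForm_apply, AddCircle.coe_add]
      congr 1
      refine Eq.trans (Finset.sum_congr rfl fun j _ => ?_) hsum.symm
      rw [mul_comm, ← zsmul_eq_mul, map_zsmul]
      rfl
    rw [h, UnitAddCircle.norm_eq, affForm, Real.norm_eq_abs]
    push_cast
    rfl
  simp only [Pi.norm_def]
  congr 2
  ext i
  exact (this i).symm

/-- The set of badly approximable systems of affine forms has Lebesgue measure zero
in `M_{m,n}(ℝ) × ℝ^m`. -/
theorem badly_approximable_affine_measure_zero (m n : ℕ) (hm : 0 < m) (hn : 0 < n) :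
    volume {x : (Fin m → Fin n → ℝ) × (Fin m → ℝ) | IsBadlyApproximable x.1 x.2} = 0 := by
  obtain ⟨n, rfl⟩ := Nat.exists_eq_succ_of_ne_zero hn.ne'
  set r : ℕ → ℕ → ℝ := fun M k =>
    (1 / ((M : ℝ) + 2) / (k : ℝ) ^ (n + 1)) ^ (1 / (m : ℝ)) with hr
  have hrpow : ∀ M k, r M k ^ m = 1 / ((M : ℝ) + 2) / (k : ℝ) ^ (n + 1) := fun M k => by
    rw [hr, one_div (m : ℝ)]
    exact Real.rpow_inv_natCast_pow (by positivity) hm.ne'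
  have hr0 : ∀ M k, 0 ≤ r M k := fun M k => by positivity
  have hnull : ∀ M T : ℕ, volume (torusBad m n (T + 1) (r M)) = 0 := fun M T => by
    refine volume_torusBad T.succ_pos (c := 1 / ((M : ℝ) + 2)) (by positivity) (hr0 M) ?_
      fun k _ => (hrpow M k).ge
    intro k hk
    have hk1 : (1 : ℝ) ≤ k := by exact_mod_cast (Nat.succ_pos T).trans_le hk
    refine Real.rpow_le_one (by positivity) ?_ (by positivity)
    rw [div_div, div_le_one (by positivity)]
    nlinarith [one_le_pow₀ hk1 (n := n + 1), (Nat.cast_nonneg M : (0 : ℝ) ≤ M)]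
  refine measure_mono_null ?_ (measure_iUnion_null fun M => measure_iUnion_null fun T =>
    volume_preimage_toTorus_eq_zero (hnull M T))
  rintro x ⟨c, hc, T, h⟩
  obtain ⟨M, hM⟩ := exists_nat_one_div_lt hc
  obtain ⟨S, hS⟩ := exists_nat_ge T
  refine Set.mem_iUnion₂.2 ⟨M, S, fun k hk q hq => ?_⟩
  have hk0 : (0 : ℝ) < k := by exact_mod_cast (Nat.succ_pos S).trans_le hk
  obtain ⟨p, hp⟩ := exists_norm_affForm_eq x q
  have hSk : (S : ℝ) ≤ k := by exact_mod_cast (Nat.le_succ S).trans hk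
  have hq' := norm_intCast_of_mem_shell hq
  have hbad := h p q (by rw [hq']; exact hS.trans hSk)
  rw [hp, hq'] at hbad
  refine lt_of_pow_lt_pow_left₀ m (norm_nonneg _) ?_
  rw [hrpow, div_lt_iff₀ (by positivity)]
  refine lt_of_lt_of_le ?_ hbad
  refine lt_trans ?_ hM
  gcongr
  norm_num
end
end

section
/- Let m, n be positive integers, A ∈ M_{m,n}(ℝ), b ∈ ℝ^m. Then ⟨A,b⟩ is irrational and badly approximable if and only if there exists ε > 0 such that for all t ≥ 0, all p ∈ ℤ^m and all q ∈ ℤ^n one has max( e^{t/m}·‖Aq + b + p‖ , e^{-t/n}·‖q‖ ) ≥ ε. -/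
open MeasureTheory Filter

noncomputable section

/-- The system `⟨A, b⟩` is rational if `Aq₀ + b + p₀ = 0` for some integer vectors
`p₀, q₀`, and irrational otherwise. -/
def IsRationalSystem {m n : ℕ} (A : Fin m → Fin n → ℝ) (b : Fin m → ℝ) : Prop :=
  ∃ p₀ : Fin m → ℤ, ∃ q₀ : Fin n → ℤ, affForm A b q₀ p₀ = 0

theorem exists_pos_le_norm_affForm {m n : ℕ} {A : Fin m → Fin n → ℝ} {b : Fin m → ℝ}
    (h : ¬ IsRationalSystem A b) (q : Fin n → ℤ) :
    ∃ δ > (0 : ℝ), ∀ p : Fin m → ℤ, δ ≤ ‖affForm A b q p‖ := by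
  set v : Fin m → ℝ := fun i => (∑ j, A i j * (q j : ℝ)) + b i with hv
  obtain ⟨i, hi⟩ : ∃ i, v i - round (v i) ≠ 0 := by
    by_contra! hc
    refine h ⟨fun i => -round (v i), q, funext fun i => ?_⟩
    simpa [affForm, hv, sub_eq_add_neg] using hc i
  refine ⟨|v i - round (v i)|, abs_pos.2 hi, fun p => ?_⟩
  have hp : affForm A b q p i = v i - ((-p i : ℤ) : ℝ) := by simp [affForm, hv]
  calc |v i - round (v i)| ≤ |v i - ((-p i : ℤ) : ℝ)| := round_le _ _
    _ = ‖affForm A b q p i‖ := by rw [hp, Real.norm_eq_abs]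
    _ ≤ ‖affForm A b q p‖ := norm_le_pi_norm _ i

theorem finite_setOf_norm_intCast_lt (n : ℕ) (T : ℝ) :
    {q : Fin n → ℤ | ‖intCast q‖ < T}.Finite := by
  refine (Set.finite_Icc (fun _ => -⌈T⌉) (fun _ => ⌈T⌉)).subset fun q hq => ?_
  have hle (i : Fin n) : |(q i : ℝ)| ≤ ⌈T⌉ :=
    ((norm_le_pi_norm (intCast q) i).trans (le_of_lt hq)).trans (Int.le_ceil T)
  exact ⟨fun i => by exact_mod_cast (abs_le.1 (hle i)).1,
    fun i => by exact_mod_cast (abs_le.1 (hle i)).2⟩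

/-- For irrational systems, the values `Aq + b + p` with `q` bounded stay away from zero. -/
theorem exists_pos_le_norm_affForm_of_norm_lt {m n : ℕ} {A : Fin m → Fin n → ℝ} {b : Fin m → ℝ}
    (h : ¬ IsRationalSystem A b) (T : ℝ) :
    ∃ δ > (0 : ℝ), ∀ p : Fin m → ℤ, ∀ q : Fin n → ℤ, ‖intCast q‖ < T →
      δ ≤ ‖affForm A b q p‖ := by
  have hev : ∀ᶠ δ in nhdsWithin (0 : ℝ) (Set.Ioi 0), ∀ q ∈ {q : Fin n → ℤ | ‖intCast q‖ < T},
      ∀ p, δ ≤ ‖affForm A b q p‖ := by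
    refine (finite_setOf_norm_intCast_lt n T).eventually_all.2 fun q _ => ?_
    obtain ⟨δ, hδ, hle⟩ := exists_pos_le_norm_affForm h q
    filter_upwards [Ioo_mem_nhdsGT hδ] with x hx p
    exact hx.2.le.trans (hle p)
  obtain ⟨δ, hδ, hpos⟩ := (hev.and self_mem_nhdsWithin).exists
  exact ⟨δ, hpos, fun p q hq => hδ q hq p⟩

theorem exp_div_natCast_pow (t : ℝ) {k : ℕ} (hk : 0 < k) :
    Real.exp (t / k) ^ k = Real.exp t := by
  rw [← Real.exp_nat_mul, mul_div_cancel₀ t (by positivity)]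

/-- Inhomogeneous Dani correspondence: `⟨A, b⟩` is irrational and badly approximable
iff there is `ε > 0` with `max(e^{t/m}‖Aq + b + p‖, e^{-t/n}‖q‖) ≥ ε` for all `t ≥ 0`,
`p ∈ ℤ^m`, `q ∈ ℤ^n`. -/
theorem irrational_badly_approximable_iff (m n : ℕ) (hm : 0 < m) (hn : 0 < n)
    (A : Fin m → Fin n → ℝ) (b : Fin m → ℝ) :
    (¬ IsRationalSystem A b ∧ IsBadlyApproximable A b) ↔
      ∃ ε > (0 : ℝ), ∀ t : ℝ, 0 ≤ t → ∀ p : Fin m → ℤ, ∀ q : Fin n → ℤ,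
        ε ≤ max (Real.exp (t / m) * ‖affForm A b q p‖)
                (Real.exp (-t / n) * ‖intCast q‖) := by
  constructor
  · rintro ⟨hirr, c, hc, T, hT⟩
    obtain ⟨δ, hδ, hlow⟩ := exists_pos_le_norm_affForm_of_norm_lt hirr T
    refine ⟨min δ (min 1 (c / 2)), by positivity, fun t ht p q => ?_⟩
    set ε := min δ (min 1 (c / 2)) with hε
    have hε₀ : 0 < ε := by positivity
    rcases lt_or_ge ‖intCast q‖ T with hq | hq
    · calc ε ≤ δ := min_le_left _ _
        _ ≤ ‖affForm A b q p‖ := hlow p q hq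
        _ ≤ Real.exp (t / m) * ‖affForm A b q p‖ :=
          le_mul_of_one_le_left (norm_nonneg _) (Real.one_le_exp (by positivity))
        _ ≤ _ := le_max_left _ _
    · by_contra! hlt
      obtain ⟨h₁, h₂⟩ := max_lt_iff.1 hlt
      have hε₁ : ε ≤ 1 := (min_le_right _ _).trans (min_le_left _ _)
      have hε₂ : ε ≤ c / 2 := (min_le_right _ _).trans (min_le_right _ _)
      have : c ≤ ε := calc
        c ≤ ‖affForm A b q p‖ ^ m * ‖intCast q‖ ^ n := hT p q hq
        _ = (Real.exp (t / m) * ‖affForm A b q p‖) ^ m *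
            (Real.exp (-t / n) * ‖intCast q‖) ^ n := by
          rw [mul_pow, mul_pow, exp_div_natCast_pow t hm, exp_div_natCast_pow (-t) hn,
            mul_mul_mul_comm, ← Real.exp_add, add_neg_cancel, Real.exp_zero, one_mul]
        _ ≤ ε ^ m * ε ^ n := by gcongr
        _ ≤ ε * 1 := by
          gcongr
          · exact pow_le_of_le_one hε₀.le hε₁ hm.ne'
          · exact pow_le_one₀ hε₀.le hε₁
        _ = ε := mul_one ε
      linarith
  · rintro ⟨ε, hε, h⟩
    refine ⟨?_, ε ^ m * (ε / 2) ^ n, by positivity, ε / 2, fun p q hq => ?_⟩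
    · rintro ⟨p, q, hpq⟩
      have hlim : Tendsto (fun t : ℝ => Real.exp (-t / n) * ‖intCast q‖) atTop (nhds 0) := by
        have hn' : (0 : ℝ) < n := by exact_mod_cast hn
        simpa using (Real.tendsto_exp_atBot.comp
          (tendsto_neg_atTop_atBot.atBot_div_const hn')).mul_const ‖intCast q‖
      obtain ⟨t, hlt, ht⟩ := ((hlim.eventually_lt_const hε).and (eventually_ge_atTop 0)).exists
      have := h t ht p q
      rw [hpq, norm_zero, mul_zero] at this
      exact this.not_gt (max_lt hε hlt)
    · have hq₀ : 0 < ‖intCast q‖ := by linarith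
      set s := ‖intCast q‖ / (ε / 2) with hs
      have hs₁ : 1 ≤ s := (one_le_div (by positivity)).2 hq
      have hs₀ : 0 < s := by positivity
      have hexp : Real.exp (-(n * Real.log s) / n) * ‖intCast q‖ = ε / 2 := by
        rw [neg_div, mul_div_cancel_left₀ _ (by positivity), Real.exp_neg, Real.exp_log hs₀, hs]
        field_simp
      have hmax := h (n * Real.log s) (mul_nonneg n.cast_nonneg (Real.log_nonneg hs₁)) p q
      rw [hexp] at hmax
      have hle := (le_max_iff.1 hmax).resolve_right (by linarith)
      calc ε ^ m * (ε / 2) ^ n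
          ≤ (Real.exp (n * Real.log s / m) * ‖affForm A b q p‖) ^ m * (ε / 2) ^ n := by gcongr
        _ = ‖affForm A b q p‖ ^ m * (s * (ε / 2)) ^ n := by
          rw [mul_pow, exp_div_natCast_pow _ hm, Real.exp_nat_mul, Real.exp_log hs₀, mul_pow]
          ring
        _ = ‖affForm A b q p‖ ^ m * ‖intCast q‖ ^ n := by
          rw [hs, div_mul_cancel₀ _ (by positivity)]
end
end

section
/- Let m, n be positive integers, A ∈ M_{m,n}(ℝ), b ∈ ℝ^m, and suppose ⟨A,b⟩ is rational, i.e. there exist p₀ ∈ ℤ^m and q₀ ∈ ℤ^n with Aq₀ + b + p₀ = 0. Then the liminf, over pairs (p,q) ∈ ℤ^m × ℤ^n with ‖q‖ → ∞, of ‖Aq + b + p‖^m · ‖q‖^n equals the liminf, over pairs (p,q) ∈ ℤ^m × ℤ^n with ‖q‖ → ∞, of ‖Aq + p‖^m · ‖q‖^n. In particular, ⟨A,b⟩ is badly approximable if and only if A is badly approximable. -/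
open MeasureTheory Filter

noncomputable section

/-- The value `Aq + p` of the system of linear forms `A` at `q`, shifted by `p`. -/
def linForm {m n : ℕ} (A : Fin m → Fin n → ℝ)
    (q : Fin n → ℤ) (p : Fin m → ℤ) : Fin m → ℝ :=
  fun i => (∑ j, A i j * (q j : ℝ)) + (p i : ℝ)

/-- The system of linear forms `A` is badly approximable. -/
def IsBadlyApproximableLin {m n : ℕ} (A : Fin m → Fin n → ℝ) : Prop :=
  ∃ c > (0 : ℝ), ∃ T : ℝ, ∀ p : Fin m → ℤ, ∀ q : Fin n → ℤ,
    T ≤ ‖intCast q‖ → c ≤ ‖linForm A q p‖ ^ m * ‖intCast q‖ ^ n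

/-- The filter of pairs `(p, q) ∈ ℤ^m × ℤ^n` with `‖q‖ → ∞`. -/
def qTop (m n : ℕ) : Filter ((Fin m → ℤ) × (Fin n → ℤ)) :=
  Filter.comap (fun v => ‖intCast v.2‖) Filter.atTop

/-- Translating by an integer vector changes the `n`-th power of the sup norm by a factor
tending to `1`. -/
lemma eventually_norm_intCast_add_pow_le {m n : ℕ} (q₀ : Fin n → ℤ) (k : ℕ) {μ : ℝ}
    (hμ : 1 < μ) :
    ∀ᶠ v in qTop m n, ‖intCast (v.2 + q₀)‖ ^ k ≤ μ * ‖intCast v.2‖ ^ k := by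
  have hlim : Tendsto (fun t : ℝ => (1 + ‖intCast q₀‖ / t) ^ k) atTop (nhds 1) := by
    simpa using ((tendsto_const_nhds (x := (1 : ℝ))).add
      ((tendsto_const_nhds (x := ‖intCast q₀‖)).div_atTop tendsto_id)).pow k
  have hev := (hlim.eventually (gt_mem_nhds hμ)).and (eventually_gt_atTop (0 : ℝ))
  refine (tendsto_comap.eventually hev).mono fun v hv => ?_
  obtain ⟨hlt, hpos⟩ := hv
  have hadd : intCast (v.2 + q₀) = intCast v.2 + intCast q₀ := by
    ext i
    simp [intCast]
  calc ‖intCast (v.2 + q₀)‖ ^ k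
      ≤ (‖intCast v.2‖ + ‖intCast q₀‖) ^ k := by
        rw [hadd]
        gcongr
        exact norm_add_le _ _
    _ = (1 + ‖intCast q₀‖ / ‖intCast v.2‖) ^ k * ‖intCast v.2‖ ^ k := by
        rw [← mul_pow]
        congr 1
        field_simp
    _ ≤ μ * ‖intCast v.2‖ ^ k := by gcongr

/-- Translation by an integer vector preserves the filter `‖q‖ → ∞`. -/
lemma tendsto_add_right_qTop {m n : ℕ} (v₀ : (Fin m → ℤ) × (Fin n → ℤ)) :
    Tendsto (fun v => v + v₀) (qTop m n) (qTop m n) := by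
  refine tendsto_comap_iff.2 (tendsto_atTop_mono (fun v => ?_)
    (tendsto_atTop_add_const_right _ (-‖intCast v₀.2‖) tendsto_comap))
  have hsub : intCast (v + v₀).2 - intCast v₀.2 = intCast v.2 := by
    ext i
    simp [intCast]
  have := norm_sub_le (intCast (v + v₀).2) (intCast v₀.2)
  rw [hsub] at this
  simp only [Function.comp_apply]
  linarith

/-- Up to an arbitrarily small loss, eventual lower bounds for `Φ v * ‖q‖ ^ n` are eventual lower
bounds for the same expression with `Φ` translated. -/
lemma eventually_le_of_translate {m n : ℕ} {Φ Ψ : (Fin m → ℤ) × (Fin n → ℤ) → ℝ}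
    (hΨ : ∀ v, 0 ≤ Ψ v) (v₀ : (Fin m → ℤ) × (Fin n → ℤ)) (h : ∀ v, Φ (v + v₀) = Ψ v)
    {a a' : ℝ} (haa : a' < a) (ha : ∀ᶠ v in qTop m n, a ≤ Φ v * ‖intCast v.2‖ ^ n) :
    ∀ᶠ v in qTop m n, a' ≤ Ψ v * ‖intCast v.2‖ ^ n := by
  rcases le_or_gt a' 0 with h0 | h0
  · exact Eventually.of_forall fun v => h0.trans (mul_nonneg (hΨ v) (by positivity))
  filter_upwards [(tendsto_add_right_qTop v₀).eventually ha,
    eventually_norm_intCast_add_pow_le v₀.2 n ((one_lt_div h0).2 haa)] with v h1 h2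
  rw [h] at h1
  have h3 : a ≤ a / a' * (Ψ v * ‖intCast v.2‖ ^ n) := by
    calc a ≤ Ψ v * ‖intCast (v.2 + v₀.2)‖ ^ n := h1
      _ ≤ Ψ v * (a / a' * ‖intCast v.2‖ ^ n) := mul_le_mul_of_nonneg_left h2 (hΨ v)
      _ = a / a' * (Ψ v * ‖intCast v.2‖ ^ n) := by ring
  rw [div_mul_eq_mul_div, le_div_iff₀ h0] at h3
  exact le_of_mul_le_mul_left h3 (h0.trans haa)

/-- Sets of reals with the same strict lower approximants have the same supremum. -/
lemma Real.sSup_eq_of_forall_lt_mem {S T : Set ℝ} (hS : S.Nonempty)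
    (hST : ∀ a ∈ S, ∀ a' < a, a' ∈ T) (hTS : ∀ a ∈ T, ∀ a' < a, a' ∈ S) :
    sSup S = sSup T := by
  have hub : upperBounds S = upperBounds T := by
    ext x
    exact ⟨fun hx a ha => le_of_forall_lt fun a' h => by
        obtain ⟨d, hd, hd'⟩ := exists_between h
        exact hd.trans_le (hx (hTS a ha d hd')),
      fun hx a ha => le_of_forall_lt fun a' h => by
        obtain ⟨d, hd, hd'⟩ := exists_between h
        exact hd.trans_le (hx (hST a ha d hd'))⟩
  by_cases hb : BddAbove S
  · obtain ⟨a, ha⟩ := hS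
    exact (((isLUB_congr hub).1 (isLUB_csSup ⟨a, ha⟩ hb)).csSup_eq
      ⟨a - 1, hST a ha _ (by linarith)⟩).symm
  · have hb' : ¬ BddAbove T := by rwa [BddAbove, ← hub]
    rw [Real.sSup_of_not_bddAbove hb, Real.sSup_of_not_bddAbove hb']

lemma eventually_qTop_iff {m n : ℕ} {P : (Fin m → ℤ) × (Fin n → ℤ) → Prop} :
    (∀ᶠ v in qTop m n, P v) ↔
      ∃ T : ℝ, ∀ p : Fin m → ℤ, ∀ q : Fin n → ℤ, T ≤ ‖intCast q‖ → P (p, q) := by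
  rw [qTop, (atTop_basis.comap _).eventually_iff]
  simp

lemma affForm_add {m n : ℕ} {A : Fin m → Fin n → ℝ} {b : Fin m → ℝ} {p₀ : Fin m → ℤ}
    {q₀ : Fin n → ℤ} (h : affForm A b q₀ p₀ = 0) (q : Fin n → ℤ) (p : Fin m → ℤ) :
    affForm A b (q + q₀) (p + p₀) = linForm A q p := by
  ext i
  have hi := congrFun h i
  simp only [affForm, linForm, Pi.add_apply, Pi.zero_apply, Int.cast_add, mul_add,
    Finset.sum_add_distrib] at hi ⊢
  linarith

/-- For a rational system `⟨A, b⟩`, the liminf of `‖Aq + b + p‖^m ‖q‖^n` over pairs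
`(p, q)` with `‖q‖ → ∞` coincides with the liminf of `‖Aq + p‖^m ‖q‖^n`; in
particular `⟨A, b⟩` is badly approximable iff `A` is. -/
theorem rational_system_liminf_eq (m n : ℕ) (hm : 0 < m) (hn : 0 < n)
    (A : Fin m → Fin n → ℝ) (b : Fin m → ℝ)
    (hrat : ∃ p₀ : Fin m → ℤ, ∃ q₀ : Fin n → ℤ, affForm A b q₀ p₀ = 0) :
    liminf (fun v : (Fin m → ℤ) × (Fin n → ℤ) =>
        ‖affForm A b v.2 v.1‖ ^ m * ‖intCast v.2‖ ^ n) (qTop m n) =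
      liminf (fun v : (Fin m → ℤ) × (Fin n → ℤ) =>
        ‖linForm A v.2 v.1‖ ^ m * ‖intCast v.2‖ ^ n) (qTop m n) ∧
    (IsBadlyApproximable A b ↔ IsBadlyApproximableLin A) := by
  obtain ⟨p₀, q₀, h₀⟩ := hrat
  have hto : ∀ a, (∀ᶠ v in qTop m n, a ≤ ‖affForm A b v.2 v.1‖ ^ m * ‖intCast v.2‖ ^ n) →
      ∀ a' < a, ∀ᶠ v in qTop m n, a' ≤ ‖linForm A v.2 v.1‖ ^ m * ‖intCast v.2‖ ^ n :=
    fun a ha a' haa => eventually_le_of_translate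
      (Φ := fun v => ‖affForm A b v.2 v.1‖ ^ m) (Ψ := fun v => ‖linForm A v.2 v.1‖ ^ m)
      (fun v => by positivity) (p₀, q₀)
      (fun v => by simp only [Prod.snd_add, Prod.fst_add, affForm_add h₀]) haa ha
  have hfrom : ∀ a, (∀ᶠ v in qTop m n, a ≤ ‖linForm A v.2 v.1‖ ^ m * ‖intCast v.2‖ ^ n) →
      ∀ a' < a, ∀ᶠ v in qTop m n, a' ≤ ‖affForm A b v.2 v.1‖ ^ m * ‖intCast v.2‖ ^ n :=
    fun a ha a' haa => eventually_le_of_translate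
      (Φ := fun v => ‖linForm A v.2 v.1‖ ^ m) (Ψ := fun v => ‖affForm A b v.2 v.1‖ ^ m)
      (fun v => by positivity) (-(p₀, q₀))
      (fun v => by
        rw [← affForm_add h₀]
        simp) haa ha
  refine ⟨?_, ?_⟩
  · rw [liminf_eq, liminf_eq]
    refine Real.sSup_eq_of_forall_lt_mem ⟨0, ?_⟩ hto hfrom
    rw [Set.mem_ofPred_eq]
    exact Eventually.of_forall fun v => by positivity
  · constructor
    · rintro ⟨c, hc, h⟩
      exact ⟨c / 2, half_pos hc,
        eventually_qTop_iff.1 (hto c (eventually_qTop_iff.2 h) _ (half_lt_self hc))⟩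
    · rintro ⟨c, hc, h⟩
      exact ⟨c / 2, half_pos hc,
        eventually_qTop_iff.1 (hfrom c (eventually_qTop_iff.2 h) _ (half_lt_self hc))⟩
end
end

section
/- Let H be a group equipped with a metric invariant under right translations and a Borel measure ν invariant under right translations. Let V be an open bounded subset of H with 0 < ν(V) < ∞ and ν(∂V) = 0, and let Λ ⊆ H be a countable subset such that the translates Vγ₁ and Vγ₂ are disjoint for distinct γ₁, γ₂ ∈ Λ and the closures V̄γ, γ ∈ Λ, cover H. Then for every ν-measurable subset A of H one has ν(A)/ν(V) ≤ #{γ ∈ Λ : Vγ ∩ A ≠ ∅} ≤ ν({h ∈ H : dist(h,A) ≤ diam(V)}) / ν(V) (where the cardinality is taken in ℕ ∪ {∞}). -/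
open MeasureTheory Filter
open scoped ENNReal

noncomputable section

/-- Counting estimate for a tessellation `(V, Λ)` of a group `H` (with right-invariant
metric and right-invariant measure): for any measurable `A ⊆ H`,
`ν(A)/ν(V) ≤ #{γ ∈ Λ : Vγ ∩ A ≠ ∅} ≤ ν({h : dist(h, A) ≤ diam V})/ν(V)`. -/
theorem tessellation_counting
    {H : Type*} [Group H] [MetricSpace H] [MeasurableSpace H] [BorelSpace H]
    (hdist : ∀ g x y : H, dist (x * g) (y * g) = dist x y)
    (ν : Measure H)
    (hνinv : ∀ (g : H) (s : Set H), ν ((fun h => h * g) ⁻¹' s) = ν s)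
    (V : Set H) (hVopen : IsOpen V) (hVbdd : Bornology.IsBounded V)
    (hVpos : 0 < ν V) (hVfin : ν V < ⊤) (hVbdry : ν (frontier V) = 0)
    (Λ : Set H) (hΛcnt : Λ.Countable)
    (hdisj : ∀ γ₁ ∈ Λ, ∀ γ₂ ∈ Λ, γ₁ ≠ γ₂ →
      Disjoint ((fun v => v * γ₁) '' V) ((fun v => v * γ₂) '' V))
    (hcover : ⋃ γ ∈ Λ, (fun v => v * γ) '' closure V = Set.univ)
    (A : Set H) (hA : MeasurableSet A) :
    ν A / ν V ≤ ({γ ∈ Λ | (((fun v => v * γ) '' V) ∩ A).Nonempty}.encard : ℝ≥0∞) ∧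
    ({γ ∈ Λ | (((fun v => v * γ) '' V) ∩ A).Nonempty}.encard : ℝ≥0∞) ≤
      ν {h : H | Metric.infDist h A ≤ Metric.diam V} / ν V := by
  set S := {γ ∈ Λ | (((fun v => v * γ) '' V) ∩ A).Nonempty}
  have hScnt : S.Countable := hΛcnt.mono (Set.sep_subset _ _)
  have hmeas : ∀ (γ : H) (s : Set H), ν ((fun v => v * γ) '' s) = ν s := fun γ s => by
    rw [Set.image_mul_right]
    exact hνinv γ⁻¹ s
  have hunion : ν (⋃ γ ∈ S, (fun v => v * γ) '' V) = (S.encard : ℝ≥0∞) * ν V := by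
    rw [measure_biUnion hScnt (fun γ₁ h₁ γ₂ h₂ hne => hdisj γ₁ h₁.1 γ₂ h₂.1 hne)]
    · simp only [hmeas]
      exact ENNReal.tsum_set_const S (ν V)
    · intro γ _
      rw [Set.image_mul_right]
      exact (hVopen.preimage (Isometry.of_dist_eq (hdist γ⁻¹)).continuous).measurableSet
  constructor
  · refine ENNReal.div_le_of_le_mul ?_
    have hsub : A ⊆ (⋃ γ ∈ S, (fun v => v * γ) '' V) ∪
        ⋃ γ ∈ Λ, (fun v => v * γ) '' frontier V := by
      intro a ha
      have ha' : a ∈ ⋃ γ ∈ Λ, (fun v => v * γ) '' closure V := hcover ▸ Set.mem_univ a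
      obtain ⟨γ, hγ, v, hv, rfl⟩ := Set.mem_iUnion₂.1 ha'
      by_cases hvV : v ∈ V
      · exact Or.inl (Set.mem_biUnion (show γ ∈ S from
          ⟨hγ, _, Set.mem_image_of_mem _ hvV, ha⟩) (Set.mem_image_of_mem _ hvV))
      · refine Or.inr (Set.mem_biUnion hγ (Set.mem_image_of_mem _ ?_))
        rw [hVopen.frontier_eq]
        exact ⟨hv, hvV⟩
    have hnull : ν (⋃ γ ∈ Λ, (fun v => v * γ) '' frontier V) = 0 :=
      (measure_biUnion_null_iff hΛcnt).2 fun γ _ => (hmeas γ _).trans hVbdry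
    calc ν A ≤ _ := measure_mono hsub
      _ ≤ _ := measure_union_le _ _
      _ = _ := by rw [hnull, add_zero, hunion]
  · rw [ENNReal.le_div_iff_mul_le (Or.inl hVpos.ne') (Or.inl hVfin.ne), ← hunion]
    refine measure_mono (Set.iUnion₂_subset ?_)
    rintro γ ⟨-, _, ⟨w, hw, rfl⟩, hwA⟩ _ ⟨v, hv, rfl⟩
    calc Metric.infDist (v * γ) A ≤ dist (v * γ) (w * γ) := Metric.infDist_le_dist_of_mem hwA
      _ = dist v w := hdist γ v w
      _ ≤ Metric.diam V := Metric.dist_le_diam_of_mem hVbdd hv hw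
end
end

section
/- Let m, n be positive integers. The set of vectors b ∈ ℝ^m such that { A ∈ M_{m,n}(ℝ) : ⟨A,b⟩ is badly approximable } is thick in M_{m,n}(ℝ), is itself a thick subset of ℝ^m; that is, for every nonempty open subset U of ℝ^m, the Hausdorff dimension of U ∩ { b ∈ ℝ^m : for every nonempty open W ⊆ M_{m,n}(ℝ), dimH( W ∩ {A : ⟨A,b⟩ badly approximable} ) = mn } equals m. -/
open MeasureTheory Filter

noncomputable section

/-- An additive map `ψ` from a discrete group has *unit covolume* with respect to `μ` if `μ`
unfolds along the image of `ψ` over a probability measure. -/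
def UnitCovolume {E Z : Type*} [AddCommGroup E] [MeasurableSpace E] [AddCommGroup Z]
    (μ : Measure E) (ψ : Z →+ E) : Prop :=
  ∃ π : Measure E, IsProbabilityMeasure π ∧
    ∀ h : E → ENNReal, Measurable h → ∫⁻ x, h x ∂μ = ∫⁻ x, ∑' z, h (x + ψ z) ∂π

section Lattice

variable {E Z : Type*} [NormedAddCommGroup E] [MeasurableSpace E] [BorelSpace E]
  [AddCommGroup Z] {μ : Measure E} {ψ : Z →+ E}

lemma UnitCovolume.tsum_le_lintegral [μ.IsAddLeftInvariant] (hψ : UnitCovolume μ ψ) {ρ : ℝ}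
    (hρ : ∀ x, ∃ z, ‖x - ψ z‖ ≤ ρ) {f h : E → ENNReal} (hh : Measurable h)
    (hfh : ∀ v e, ‖e‖ ≤ ρ → f v ≤ h (v + e)) (w : E) :
    ∑' z, f (ψ z + w) ≤ ∫⁻ x, h x ∂μ := by
  obtain ⟨π, hπ, H⟩ := hψ
  rw [← lintegral_add_left_eq_self h w, H _ (by fun_prop)]
  calc ∑' z, f (ψ z + w) = ∫⁻ _, ∑' z, f (ψ z + w) ∂π := by simp
    _ ≤ _ := by
      refine lintegral_mono fun x => ?_
      obtain ⟨z₀, hz₀⟩ := hρ x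
      rw [← (Equiv.subRight z₀).tsum_eq (fun z => h (w + (x + ψ z)))]
      refine ENNReal.tsum_le_tsum fun z => ?_
      convert hfh (ψ z + w) _ hz₀ using 2
      simp
      abel

/-- The covering radius of a lattice of unit covolume is bounded in terms of the length of its
shortest vector. -/
lemma exists_covering_radius [NormedSpace ℝ E] (μ : Measure E) [μ.IsAddHaarMeasure]
    {ε : ℝ} (hε : 0 < ε) :
    ∃ ρ > 0, ∀ ψ : Z →+ E, UnitCovolume μ ψ → (∀ z ≠ 0, ε ≤ ‖ψ z‖) →
      ∀ x, ∃ z, ‖x - ψ z‖ ≤ ρ := by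
  have hpos : 0 < μ (Metric.ball 0 (ε / 2)) := Metric.measure_ball_pos _ _ (by positivity)
  obtain ⟨K, hK⟩ := ENNReal.exists_nat_mul_gt hpos.ne' ENNReal.one_ne_top
  refine ⟨(K + 1) * ε, by positivity, fun ψ ⟨π, hπ, H⟩ hψ x => ?_⟩
  by_contra! hx
  set φ : E → ℝ := fun y => Metric.infDist y (Set.range ψ) with hφ
  have hne : (Set.range ψ).Nonempty := Set.range_nonempty _
  have hφ0 : φ 0 = 0 := Metric.infDist_zero_of_mem (Set.mem_range.2 ⟨0, map_zero ψ⟩)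
  have hφx : (K + 1) * ε ≤ φ x := by
    refine (Metric.le_infDist hne).2 ?_
    rintro _ ⟨z, rfl⟩
    rw [dist_eq_norm]
    exact (hx z).le
  have hφadd (y : E) (z : Z) : φ (y + ψ z) = φ y := by
    have key : ∀ (y : E) (z : Z), φ (y + ψ z) ≤ φ y := fun y z => by
      refine (Metric.le_infDist hne).2 ?_
      rintro _ ⟨z', rfl⟩
      refine (Metric.infDist_le_dist_of_mem (Set.mem_range_self (z' + z))).trans ?_
      simp [dist_eq_norm]
    refine le_antisymm (key y z) ?_
    simpa using key (y + ψ z) (-z)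
  have hcont : Continuous fun t : ℝ => φ (t • x) :=
    (Metric.continuous_infDist_pt _).comp (by fun_prop)
  have hex (j : Fin K) : ∃ t : ℝ, φ (t • x) = j * ε := by
    have hmem : (j : ℝ) * ε ∈ Set.Icc (φ ((0 : ℝ) • x)) (φ ((1 : ℝ) • x)) := by
      refine ⟨by rw [zero_smul, hφ0]; positivity, le_trans ?_ (by simpa using hφx)⟩
      have : (j : ℝ) ≤ K := by exact_mod_cast j.2.le
      nlinarith
    obtain ⟨t, -, ht⟩ := intermediate_value_Icc (zero_le_one' ℝ) hcont.continuousOn hmem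
    exact ⟨t, ht⟩
  choose t ht using hex
  set h : E → ENNReal := fun y => ∑ j : Fin K, (Metric.ball (t j • x) (ε / 2)).indicator 1 y
  have hmeas : Measurable h := Finset.measurable_sum _ fun j _ =>
    measurable_one.indicator Metric.isOpen_ball.measurableSet
  have h1 : ∫⁻ y, h y ∂μ = K * μ (Metric.ball 0 (ε / 2)) := by
    rw [lintegral_finsetSum _ fun j _ =>
      measurable_one.indicator Metric.isOpen_ball.measurableSet]
    simp [lintegral_indicator_one Metric.isOpen_ball.measurableSet,
      Measure.addHaar_ball_center]
  have h2 : ∫⁻ y, h y ∂μ ≤ 1 := by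
    rw [H h hmeas]
    calc _ ≤ ∫⁻ _, 1 ∂π := by
          refine lintegral_mono fun y => ?_
          simp only [h]
          have : ∀ z, ∑ j : Fin K, (Metric.ball (t j • x) (ε / 2)).indicator
              (1 : E → ENNReal) (y + ψ z) = ∑' j : Fin K, _ := fun z => (tsum_fintype _).symm
          simp_rw [this]
          rw [← ENNReal.tsum_prod]
          have huniq : ∀ p q : Z × Fin K, y + ψ p.1 ∈ Metric.ball (t p.2 • x) (ε / 2) →
              y + ψ q.1 ∈ Metric.ball (t q.2 • x) (ε / 2) → p = q := by
            rintro ⟨z, i⟩ ⟨z', j⟩ hp hq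
            simp only [Metric.mem_ball] at hp hq
            have hd : dist (t i • x + ψ (z' - z)) (t j • x) < ε := by
              calc _ ≤ dist (t i • x + ψ (z' - z)) (y + ψ z') + dist (y + ψ z') (t j • x) :=
                    dist_triangle _ _ _
                _ = dist (y + ψ z) (t i • x) + dist (y + ψ z') (t j • x) := by
                    congr 1
                    rw [dist_comm (y + ψ z), dist_eq_norm, dist_eq_norm, map_sub]
                    congr 1; abel
                _ < ε := by linarith
            have e1 := Metric.infDist_le_infDist_add_dist (s := Set.range ψ)
              (x := t i • x + ψ (z' - z)) (y := t j • x)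
            have e2 := Metric.infDist_le_infDist_add_dist (s := Set.range ψ)
              (y := t i • x + ψ (z' - z)) (x := t j • x)
            rw [dist_comm] at e2
            have e3 := hφadd (t i • x) (z' - z)
            simp only [hφ] at e3 ht
            rw [e3, ht, ht] at e1 e2
            have hij : i = j := by
              have a1 : (i : ℝ) < j + 1 := by nlinarith
              have a2 : (j : ℝ) < i + 1 := by nlinarith
              norm_cast at a1 a2
              exact Fin.ext (by omega)
            subst hij
            have hz : z' - z = 0 := by
              by_contra hne0
              have := hψ _ hne0
              simp [dist_eq_norm] at hd
              simp at this
              linarith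
            rw [sub_eq_zero.1 hz]
          by_cases hp : ∃ p : Z × Fin K, y + ψ p.1 ∈ Metric.ball (t p.2 • x) (ε / 2)
          · obtain ⟨p, hp⟩ := hp
            rw [tsum_eq_single p]
            · exact Set.indicator_le_self' (by simp) _
            · intro q hq
              exact Set.indicator_of_notMem (fun hq' => hq (huniq q p hq' hp)) _
          · push Not at hp
            rw [ENNReal.tsum_eq_zero.2]
            · simp
            · exact fun q => Set.indicator_of_notMem (hp q) _
      _ = 1 := by simp
  exact absurd (h1 ▸ h2) (not_le.2 hK)

end Lattice

section Flow

variable {m n : ℕ}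

instance : (volume : Measure ((Fin m → ℝ) × (Fin n → ℝ))).IsAddHaarMeasure :=
  Measure.prod.instIsAddHaarMeasure volume volume

/-- The linear map `(x, y) ↦ (S ^ n (A y + x), S ^ (-m) y)`. -/
def flow (S : ℝ) (A : Fin m → Fin n → ℝ) (z : (Fin m → ℝ) × (Fin n → ℝ)) :
    (Fin m → ℝ) × (Fin n → ℝ) :=
  (fun i => S ^ n * ((∑ j, A i j * z.2 j) + z.1 i), fun j => (S ^ m)⁻¹ * z.2 j)

/-- The image of the integer lattice under `flow S A`. -/
def latticeMap (S : ℝ) (A : Fin m → Fin n → ℝ) :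
    (Fin m → ℤ) × (Fin n → ℤ) →+ (Fin m → ℝ) × (Fin n → ℝ) where
  toFun v := flow S A (fun i => (v.1 i : ℝ), fun j => (v.2 j : ℝ))
  map_zero' := by ext i <;> simp [flow]
  map_add' v w := by
    ext i
    · simp [flow, mul_add, Finset.sum_add_distrib]; ring
    · simp [flow, mul_add]

lemma lintegral_comp_const_mul {k : ℕ} {r : ℝ} (hr : 0 < r) {h : (Fin k → ℝ) → ENNReal}
    (hh : Measurable h) :
    ∫⁻ x : Fin k → ℝ, h (fun i => r * x i) = ENNReal.ofReal ((r ^ k)⁻¹) * ∫⁻ x, h x := by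
  have e := Measure.map_addHaar_smul (volume : Measure (Fin k → ℝ)) hr.ne'
  have : ∫⁻ x : Fin k → ℝ, h (fun i => r * x i) = ∫⁻ x, h x ∂(Measure.map (r • ·) volume) := by
    rw [lintegral_map hh (measurable_const_smul r)]
    rfl
  rw [this, e, lintegral_smul_measure, abs_of_pos (by positivity)]
  simp

lemma measurable_flow (S : ℝ) (A : Fin m → Fin n → ℝ) : Measurable (flow S A) := by
  unfold flow
  fun_prop

lemma lintegral_flow {S : ℝ} (hS : 0 < S) (A : Fin m → Fin n → ℝ)
    {h : (Fin m → ℝ) × (Fin n → ℝ) → ENNReal} (hh : Measurable h) :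
    ∫⁻ z, h (flow S A z) = ∫⁻ z, h z := by
  rw [Measure.volume_eq_prod, lintegral_prod_symm' (fun z => h (flow S A z))
    (hh.comp (measurable_flow S A)), lintegral_prod_symm' _ hh]
  have key (y : Fin n → ℝ) : ∫⁻ x, h (flow S A (x, y)) =
      ENNReal.ofReal (((S ^ n) ^ m)⁻¹) * ∫⁻ x, h (x, fun j => (S ^ m)⁻¹ * y j) := by
    have h1 : Measurable fun x => h (x, fun j => (S ^ m)⁻¹ * y j) := by fun_prop
    rw [← lintegral_comp_const_mul (pow_pos hS n) h1]
    exact lintegral_add_left_eq_self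
      (fun x : Fin m → ℝ => h (fun i => S ^ n * x i, fun j => (S ^ m)⁻¹ * y j))
      (fun i => ∑ j, A i j * y j)
  simp_rw [key]
  have h2 : Measurable fun y => ∫⁻ x, h (x, y) := hh.lintegral_prod_left'
  rw [lintegral_const_mul _ (by fun_prop),
    lintegral_comp_const_mul (h := fun y => ∫⁻ x, h (x, y)) (by positivity) h2, ← mul_assoc,
    ← ENNReal.ofReal_mul (by positivity)]
  have : ((S ^ n) ^ m)⁻¹ * ((((S ^ m)⁻¹) ^ n)⁻¹) = 1 := by
    rw [inv_pow, inv_inv, ← pow_mul, ← pow_mul, mul_comm n m]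
    exact inv_mul_cancel₀ (by positivity)
  rw [this]
  simp

lemma unitCovolume_int :
    UnitCovolume (volume : Measure ((Fin m → ℝ) × (Fin n → ℝ)))
      (((Int.castAddHom ℝ).compLeft (Fin m)).prodMap ((Int.castAddHom ℝ).compLeft (Fin n))) := by
  set fl : (Fin m → ℝ) × (Fin n → ℝ) → (Fin m → ℤ) × (Fin n → ℤ) :=
    fun x => (fun i => ⌊x.1 i⌋, fun j => ⌊x.2 j⌋) with hfl
  have hflm : Measurable fl := by fun_prop
  have hcell : fl ⁻¹' {0} = (Set.univ.pi fun _ => Set.Ico 0 1) ×ˢ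
      (Set.univ.pi fun _ => Set.Ico 0 1) := by
    ext x
    simp [hfl, Prod.ext_iff, funext_iff, Int.floor_eq_zero_iff]
  refine ⟨volume.restrict (fl ⁻¹' {0}), ⟨?_⟩, fun h hh => ?_⟩
  · rw [Measure.restrict_apply_univ, hcell, Measure.volume_eq_prod, Measure.prod_prod,
      volume_pi_pi, volume_pi_pi]
    simp
  · rw [lintegral_tsum (fun z => by fun_prop), ← setLIntegral_univ]
    have hU : (Set.univ : Set ((Fin m → ℝ) × (Fin n → ℝ))) = ⋃ z, fl ⁻¹' {z} := by
      ext x; simp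
    rw [hU, lintegral_iUnion (fun z => hflm (measurableSet_singleton z))
      (fun a b hab => by
        refine Disjoint.preimage _ ?_
        simpa using hab)]
    refine tsum_congr fun z => ?_
    rw [← lintegral_indicator (hflm (measurableSet_singleton z)),
      ← lintegral_indicator (hflm (measurableSet_singleton 0)),
      ← lintegral_add_right_eq_self _ ((fun i => (z.1 i : ℝ), fun j => (z.2 j : ℝ)) :
        (Fin m → ℝ) × (Fin n → ℝ))]
    refine lintegral_congr fun x => ?_
    simp only [Set.indicator, Set.mem_preimage, Set.mem_singleton_iff]
    have : fl (x + ((fun i => (z.1 i : ℝ), fun j => (z.2 j : ℝ)))) = z ↔ fl x = 0 := by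
      simp [hfl, Prod.ext_iff, funext_iff]
    simp only [this]
    rfl

lemma unitCovolume_latticeMap {S : ℝ} (hS : 0 < S) (A : Fin m → Fin n → ℝ) :
    UnitCovolume volume (latticeMap S A) := by
  obtain ⟨π, hπ, H⟩ := unitCovolume_int (m := m) (n := n)
  refine ⟨π.map (flow S A), Measure.isProbabilityMeasure_map (measurable_flow S A).aemeasurable,
    fun h hh => ?_⟩
  rw [← lintegral_flow hS A hh, H (fun z => h (flow S A z)) (hh.comp (measurable_flow S A)),
    lintegral_map (by fun_prop) (measurable_flow S A)]
  refine lintegral_congr fun x => tsum_congr fun z => congrArg h ?_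
  ext i
  · simp [flow, latticeMap, mul_add, Finset.sum_add_distrib]; ring
  · simp [flow, latticeMap, mul_add]

end Flow

section Step

variable {m n : ℕ}

lemma volume_abs_affine_le {a b η : ℝ} (hb : b ≠ 0) :
    volume {u : ℝ | |a + u * b| ≤ η} ≤ ENNReal.ofReal (2 * η / |b|) := by
  have hsub : {u : ℝ | |a + u * b| ≤ η} ⊆ Metric.closedBall (-a / b) (η / |b|) := by
    intro u hu
    rw [Metric.mem_closedBall, Real.dist_eq, le_div_iff₀ (abs_pos.2 hb), ← abs_mul]
    rw [Set.mem_ofPred_eq] at hu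
    have e : (u - -a / b) * b = a + u * b := by
      field_simp
      ring
    rwa [e]
  refine (measure_mono hsub).trans ?_
  rw [Real.volume_closedBall]
  exact ENNReal.ofReal_le_ofReal (le_of_eq (by ring))

lemma volume_strip_le {y : Fin n → ℝ} (hy : y ≠ 0) (x η : ℝ) :
    volume {a : Fin n → ℝ | (∀ j, a j ∈ Set.Icc (0 : ℝ) 1) ∧ |x + ∑ j, a j * y j| ≤ η} ≤
      ENNReal.ofReal (2 * η / ‖y‖) := by
  cases n with
  | zero => exact absurd (Subsingleton.elim _ _) hy
  | succ n =>
    obtain ⟨i, -, hi⟩ := Finset.exists_mem_eq_sup' Finset.univ_nonempty fun j => ‖y j‖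
    have hyi : ‖y‖ = |y i| := by
      rw [← Real.norm_eq_abs, ← hi]
      refine le_antisymm ((pi_norm_le_iff_of_nonempty _).2 fun j => ?_) ?_
      · exact Finset.le_sup' (fun j => ‖y j‖) (Finset.mem_univ j)
      · exact Finset.sup'_le _ _ fun j _ => norm_le_pi_norm y j
    have hne : y i ≠ 0 := by
      have := norm_pos_iff.2 hy
      rw [hyi] at this
      exact abs_pos.1 this
    set T : Set (ℝ × (Fin n → ℝ)) :=
      {p | (∀ j, p.2 j ∈ Set.Icc (0 : ℝ) 1) ∧
        |(x + ∑ j, p.2 j * y (i.succAbove j)) + p.1 * y i| ≤ η} with hT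
    have hTm : MeasurableSet T := by
      refine MeasurableSet.inter (s₁ := {p : ℝ × (Fin n → ℝ) | ∀ j, p.2 j ∈ Set.Icc (0 : ℝ) 1})
        (s₂ := {p : ℝ × (Fin n → ℝ) | |(x + ∑ j, p.2 j * y (i.succAbove j)) + p.1 * y i| ≤ η}) ?_
        (measurableSet_le (by fun_prop) measurable_const)
      simp only [Set.ofPred_forall]
      exact MeasurableSet.iInter fun j =>
        measurableSet_Icc.preimage (f := fun p : ℝ × (Fin n → ℝ) => p.2 j) (by fun_prop)
    have hmp := volume_preserving_piFinSuccAbove (fun _ : Fin (n + 1) => ℝ) i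
    calc _ ≤ volume ((MeasurableEquiv.piFinSuccAbove (fun _ : Fin (n + 1) => ℝ) i) ⁻¹' T) := by
          refine measure_mono fun a ha => ?_
          refine ⟨fun j => ha.1 _, ?_⟩
          have := ha.2
          rw [Fin.sum_univ_succAbove _ i] at this
          convert this using 2
          simp [Fin.removeNth]
          ring
      _ = volume T := hmp.measure_preimage hTm.nullMeasurableSet
      _ = ∫⁻ v, volume ((fun u => (u, v)) ⁻¹' T) := by
          rw [Measure.volume_eq_prod, Measure.prod_apply_symm hTm]
      _ ≤ ∫⁻ v, (Set.univ.pi fun _ => Set.Icc (0 : ℝ) 1).indicator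
            (fun _ => ENNReal.ofReal (2 * η / ‖y‖)) v := by
          refine lintegral_mono fun v => ?_
          by_cases hv : ∀ j, v j ∈ Set.Icc (0 : ℝ) 1
          · rw [Set.indicator_of_mem (Set.mem_univ_pi.2 hv), hyi]
            refine le_trans (measure_mono fun u hu => ?_)
              (volume_abs_affine_le (a := x + ∑ j, v j * y (i.succAbove j)) hne)
            exact hu.2
          · have : (fun u : ℝ => (u, v)) ⁻¹' T = ∅ := by
              ext u
              simp only [hT, Set.mem_preimage, Set.mem_ofPred_eq, hv, false_and]
              rfl
            simp [this]
      _ ≤ _ := by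
          rw [lintegral_indicator_const (MeasurableSet.univ_pi fun _ => measurableSet_Icc),
            volume_pi_pi]
          simp

lemma volume_matrix_strip_le {y : Fin n → ℝ} (hy : y ≠ 0) (x : Fin m → ℝ) {η : ℝ} (hη : 0 ≤ η) :
    volume {X : Fin m → Fin n → ℝ | (∀ i j, X i j ∈ Set.Icc (0 : ℝ) 1) ∧
      ∀ i, |x i + ∑ j, X i j * y j| ≤ η} ≤ ENNReal.ofReal ((2 * η / ‖y‖) ^ m) := by
  calc _ ≤ volume (Set.univ.pi fun i : Fin m =>
        {a : Fin n → ℝ | (∀ j, a j ∈ Set.Icc (0 : ℝ) 1) ∧ |x i + ∑ j, a j * y j| ≤ η}) :=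
        measure_mono fun X hX i _ => ⟨hX.1 i, hX.2 i⟩
    _ ≤ ∏ _i : Fin m, ENNReal.ofReal (2 * η / ‖y‖) := by
        rw [volume_pi_pi]
        exact Finset.prod_le_prod' fun i _ => volume_strip_le hy _ _
    _ = _ := by
        rw [Finset.prod_const, Finset.card_univ, Fintype.card_fin,
          ENNReal.ofReal_pow (by positivity)]

lemma lintegral_cone_le {C Y c : ℝ} (hC : 0 ≤ C) (hY : 0 ≤ Y) (hc : 0 ≤ c) :
    ∫⁻ z : (Fin m → ℝ) × (Fin n → ℝ), {z | ‖z.1‖ ≤ C * ‖z.2‖ ∧ ‖z.2‖ ≤ Y}.indicator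
      (fun z => ENNReal.ofReal (c * ‖z.2‖⁻¹ ^ m)) z ≤
      ENNReal.ofReal (c * (2 * C) ^ m * (2 * Y) ^ n) := by
  set T : Set ((Fin m → ℝ) × (Fin n → ℝ)) := {z | ‖z.1‖ ≤ C * ‖z.2‖ ∧ ‖z.2‖ ≤ Y}
  have hT : MeasurableSet T :=
    MeasurableSet.inter (s₁ := {z : (Fin m → ℝ) × (Fin n → ℝ) | ‖z.1‖ ≤ C * ‖z.2‖})
      (s₂ := {z : (Fin m → ℝ) × (Fin n → ℝ) | ‖z.2‖ ≤ Y})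
      (measurableSet_le (by fun_prop) (by fun_prop))
      (measurableSet_le (by fun_prop) (by fun_prop))
  rw [Measure.volume_eq_prod, lintegral_prod_symm' _ (Measurable.indicator (by fun_prop) hT)]
  calc _ ≤ ∫⁻ y, (Metric.closedBall (0 : Fin n → ℝ) Y).indicator
        (fun _ => ENNReal.ofReal (c * (2 * C) ^ m)) y := by
        refine lintegral_mono fun y => ?_
        by_cases hy : y ∈ Metric.closedBall (0 : Fin n → ℝ) Y
        · rw [Set.indicator_of_mem hy]
          calc _ ≤ ∫⁻ x, (Metric.closedBall (0 : Fin m → ℝ) (C * ‖y‖)).indicator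
                (fun _ => ENNReal.ofReal (c * ‖y‖⁻¹ ^ m)) x := by
                refine lintegral_mono fun x => ?_
                by_cases hx : (x, y) ∈ T
                · rw [Set.indicator_of_mem hx, Set.indicator_of_mem (by simpa using hx.1)]
                · rw [Set.indicator_of_notMem hx]; simp
            _ ≤ _ := by
                rw [lintegral_indicator_const Metric.isClosed_closedBall.measurableSet,
                  Real.volume_pi_closedBall _ (by positivity), ← ENNReal.ofReal_mul (by positivity)]
                refine ENNReal.ofReal_le_ofReal ?_
                rw [Fintype.card_fin, mul_assoc, ← mul_pow]
                refine mul_le_mul_of_nonneg_left (pow_le_pow_left₀ (by positivity) ?_ _) hc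
                calc ‖y‖⁻¹ * (2 * (C * ‖y‖)) = 2 * C * (‖y‖⁻¹ * ‖y‖) := by ring
                  _ ≤ 2 * C * 1 := by
                    gcongr
                    exact inv_mul_le_one
                  _ = _ := by ring
        · rw [Set.indicator_of_notMem hy]
          simp only [nonpos_iff_eq_zero]
          rw [lintegral_eq_zero_of_ae_eq_zero]
          refine Filter.Eventually.of_forall fun x => ?_
          exact Set.indicator_of_notMem (fun h => hy (by simpa using h.2)) _
    _ = _ := by
        rw [lintegral_indicator_const Metric.isClosed_closedBall.measurableSet,
          Real.volume_pi_closedBall _ (by positivity), ← ENNReal.ofReal_mul (by positivity),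
          Fintype.card_fin]

end Step

section Bad

variable {m n : ℕ}

lemma norm_flow_lt_iff {S r : ℝ} (hr : 0 < r) (hS : 0 < S) {A : Fin m → Fin n → ℝ}
    {z : (Fin m → ℝ) × (Fin n → ℝ)} :
    ‖flow S A z‖ < r ↔ (∀ i, |(∑ j, A i j * z.2 j) + z.1 i| < r * (S ^ n)⁻¹) ∧
      ‖z.2‖ < r * S ^ m := by
  rw [Prod.norm_def, max_lt_iff, pi_norm_lt_iff hr, pi_norm_lt_iff hr,
    pi_norm_lt_iff (by positivity)]
  refine and_congr (forall_congr' fun i => ?_) (forall_congr' fun j => ?_)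
  · simp only [flow, norm_mul, Real.norm_eq_abs, abs_of_pos (pow_pos hS n)]
    rw [← div_eq_mul_inv, lt_div_iff₀ (pow_pos hS n), mul_comm]
  · simp only [flow, norm_mul, Real.norm_eq_abs, abs_inv, abs_of_pos (pow_pos hS m)]
    rw [inv_mul_lt_iff₀ (pow_pos hS m), mul_comm]

lemma volume_bad_le (hn : 0 < n) {ε M : ℝ} (hε : 0 < ε) (hM : 2 ≤ M) {X₀ : Fin m → Fin n → ℝ}
    (hX₀ : ∀ i j, X₀ i j ∈ Set.Icc (0 : ℝ) 1) {v : (Fin m → ℝ) × (Fin n → ℝ)} (hv : ε ≤ ‖v‖) :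
    volume {X : Fin m → Fin n → ℝ | (∀ i j, X i j ∈ Set.Icc (0 : ℝ) 1) ∧
      ‖flow M (X - X₀) v‖ < ε} ≤
    {v : (Fin m → ℝ) × (Fin n → ℝ) | ε ≤ 2 * n * ‖v.2‖ ∧ ‖v.1‖ ≤ 2 * n * ‖v.2‖ ∧
      ‖v.2‖ ≤ ε * M ^ m}.indicator
        (fun v => ENNReal.ofReal ((2 * ε * (M ^ n)⁻¹) ^ m * ‖v.2‖⁻¹ ^ m)) v := by
  have hM0 : 0 < M := by linarith
  rcases Set.eq_empty_or_nonempty {X : Fin m → Fin n → ℝ |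
    (∀ i j, X i j ∈ Set.Icc (0 : ℝ) 1) ∧ ‖flow M (X - X₀) v‖ < ε} with h | ⟨X, hX, hXv⟩
  · rw [h]; simp
  rw [norm_flow_lt_iff hε hM0] at hXv
  have hn1 : (1 : ℝ) ≤ n := by exact_mod_cast hn
  have hMn : ε * (M ^ n)⁻¹ ≤ ε / 2 := by
    rw [div_eq_mul_inv]
    gcongr
    calc (2 : ℝ) ≤ M := hM
      _ ≤ M ^ n := le_self_pow₀ (by linarith) hn.ne'
  have hy0 := norm_nonneg v.2
  have hx : ‖v.1‖ ≤ ε / 2 + n * ‖v.2‖ := by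
    refine (pi_norm_le_iff_of_nonneg (by positivity)).2 fun i => ?_
    have h1 := (hXv.1 i).le.trans hMn
    have h2 : |∑ j, (X - X₀) i j * v.2 j| ≤ n * ‖v.2‖ := by
      refine (Finset.abs_sum_le_sum_abs _ _).trans ?_
      calc _ ≤ ∑ _j : Fin n, ‖v.2‖ := by
            refine Finset.sum_le_sum fun j _ => ?_
            rw [abs_mul]
            have h3 : |(X - X₀) i j| ≤ 1 := by
              have := hX i j
              have := hX₀ i j
              simp only [Set.mem_Icc, Pi.sub_apply] at *
              rw [abs_le]; constructor <;> linarith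
            calc _ ≤ 1 * ‖v.2‖ := mul_le_mul h3 (norm_le_pi_norm v.2 j) (abs_nonneg _) zero_le_one
              _ = _ := one_mul _
        _ = _ := by simp
    rw [Real.norm_eq_abs]
    rw [abs_le] at *
    constructor <;> linarith
  have hy : ε ≤ 2 * n * ‖v.2‖ := by
    by_contra! hcon
    have h1 : ‖v.1‖ < ε := by linarith
    have h2 : ‖v.2‖ < ε := by nlinarith
    exact absurd hv (not_le.2 (by rw [Prod.norm_def]; exact max_lt h1 h2))
  have hy1 : v.2 ≠ 0 := by
    intro h
    rw [h] at hy
    simp at hy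
    linarith
  have hmem : v ∈ {v : (Fin m → ℝ) × (Fin n → ℝ) | ε ≤ 2 * n * ‖v.2‖ ∧ ‖v.1‖ ≤ 2 * n * ‖v.2‖ ∧
      ‖v.2‖ ≤ ε * M ^ m} := ⟨hy, by linarith, hXv.2.le⟩
  rw [Set.indicator_of_mem hmem]
  calc _ ≤ volume {X : Fin m → Fin n → ℝ | (∀ i j, X i j ∈ Set.Icc (0 : ℝ) 1) ∧
        ∀ i, |(v.1 i - ∑ j, X₀ i j * v.2 j) + ∑ j, X i j * v.2 j| ≤ ε * (M ^ n)⁻¹} := by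
        refine measure_mono fun X hX => ⟨hX.1, fun i => ?_⟩
        refine le_trans (le_of_eq ?_) (((norm_flow_lt_iff hε hM0).1 hX.2).1 i).le
        congr 1
        simp only [Pi.sub_apply, sub_mul, Finset.sum_sub_distrib]
        ring
    _ ≤ _ := volume_matrix_strip_le hy1 _ (by positivity)
    _ = _ := by
        rw [← mul_pow]
        congr 2
        ring

/-- First moment estimate: if a lattice of unit covolume has no short vectors, then for most
`X` the image of a translate of it under `flow M X` has no short vectors, apart from the images of
vectors that were already short. -/
lemma exists_volume_bad_le (hm : 0 < m) (hn : 0 < n) {δ : ℝ} (hδ : 0 < δ) :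
    ∃ ε₀ > 0, ∀ ε : ℝ, 0 < ε → ε ≤ ε₀ → ∃ M₀ : ℝ, ∀ M ≥ M₀,
      ∀ ψ : (Fin m → ℤ) × (Fin n → ℤ) →+ (Fin m → ℝ) × (Fin n → ℝ),
      UnitCovolume volume ψ → (∀ z ≠ 0, ε ≤ ‖ψ z‖) → ∀ w,
      ∀ X₀ : Fin m → Fin n → ℝ, (∀ i j, X₀ i j ∈ Set.Icc (0 : ℝ) 1) →
      volume {X : Fin m → Fin n → ℝ | (∀ i j, X i j ∈ Set.Icc (0 : ℝ) 1) ∧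
        ∃ z, ε ≤ ‖ψ z + w‖ ∧ ‖flow M (X - X₀) (ψ z + w)‖ < ε} ≤ ENNReal.ofReal δ := by
  set C₁ : ℝ := 4 ^ m * (2 * (4 * n + 1)) ^ m * 4 ^ n with hC₁
  have hC₁0 : 0 < C₁ := by positivity
  refine ⟨min 1 (δ / 2 / C₁), by positivity, fun ε hε hεle => ?_⟩
  obtain ⟨ρ, hρ, hcov⟩ := exists_covering_radius (Z := (Fin m → ℤ) × (Fin n → ℤ))
    (volume : Measure ((Fin m → ℝ) × (Fin n → ℝ))) hε
  set R : ℝ := (4 * n + 3) * ρ with hR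
  set C₂ : ℝ := (4 * n) ^ m * (2 * R) ^ (m + n) with hC₂
  refine ⟨max 2 (C₂ / (δ / 2)), fun M hM ψ hψ hψε w X₀ hX₀ => ?_⟩
  have hM2 : 2 ≤ M := (le_max_left _ _).trans hM
  have hM0 : 0 < M := by linarith
  have hn1 : (1 : ℝ) ≤ n := by exact_mod_cast hn
  have hR0 : 0 ≤ R := by positivity
  set c : ℝ := (2 * ε * (M ^ n)⁻¹) ^ m with hc
  have hc0 : 0 ≤ c := by positivity
  set T : Set ((Fin m → ℝ) × (Fin n → ℝ)) :=
    {z | ‖z.1‖ ≤ (4 * n + 1) * ‖z.2‖ ∧ ‖z.2‖ ≤ 2 * (ε * M ^ m)} with hT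
  have hTm : MeasurableSet T :=
    MeasurableSet.inter (s₁ := {z : (Fin m → ℝ) × (Fin n → ℝ) | ‖z.1‖ ≤ (4 * n + 1) * ‖z.2‖})
      (s₂ := {z : (Fin m → ℝ) × (Fin n → ℝ) | ‖z.2‖ ≤ 2 * (ε * M ^ m)})
      (measurableSet_le (by fun_prop) (by fun_prop))
      (measurableSet_le (by fun_prop) (by fun_prop))
  set h₁ : (Fin m → ℝ) × (Fin n → ℝ) → ENNReal :=
    T.indicator fun z => ENNReal.ofReal (c * 2 ^ m * ‖z.2‖⁻¹ ^ m) with hh₁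
  set h₂ : (Fin m → ℝ) × (Fin n → ℝ) → ENNReal :=
    (Metric.closedBall 0 R).indicator fun _ => ENNReal.ofReal (c * (2 * n / ε) ^ m) with hh₂
  have hm₁ : Measurable h₁ := Measurable.indicator (by fun_prop) hTm
  have hm₂ : Measurable h₂ :=
    Measurable.indicator (by fun_prop) Metric.isClosed_closedBall.measurableSet
  set g : (Fin m → ℝ) × (Fin n → ℝ) → ENNReal :=
    {v : (Fin m → ℝ) × (Fin n → ℝ) | ε ≤ 2 * n * ‖v.2‖ ∧ ‖v.1‖ ≤ 2 * n * ‖v.2‖ ∧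
      ‖v.2‖ ≤ ε * M ^ m}.indicator (fun v => ENNReal.ofReal (c * ‖v.2‖⁻¹ ^ m)) with hg
  have hgh : ∀ v e, ‖e‖ ≤ ρ → g v ≤ h₁ (v + e) + h₂ (v + e) := by
    intro v e he
    by_cases hv : v ∈ {v : (Fin m → ℝ) × (Fin n → ℝ) | ε ≤ 2 * n * ‖v.2‖ ∧
      ‖v.1‖ ≤ 2 * n * ‖v.2‖ ∧ ‖v.2‖ ≤ ε * M ^ m}
    swap
    · rw [hg, Set.indicator_of_notMem hv]; exact zero_le
    rw [hg, Set.indicator_of_mem hv]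
    obtain ⟨hv1, hv2, hv3⟩ := hv
    have he1 : ‖e.1‖ ≤ ρ := (norm_fst_le e).trans he
    have he2 : ‖e.2‖ ≤ ρ := (norm_snd_le e).trans he
    have hy0 : 0 < ‖v.2‖ := by
      by_contra! hcon
      nlinarith
    have a1 : ‖(v + e).1‖ ≤ ‖v.1‖ + ‖e.1‖ := norm_add_le _ _
    have a2 : ‖(v + e).2‖ ≤ ‖v.2‖ + ‖e.2‖ := norm_add_le _ _
    have a3 : ‖v.2‖ ≤ ‖(v + e).2‖ + ‖e.2‖ := by
      have := norm_sub_le (v + e).2 e.2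
      simpa using this
    by_cases hbig : 2 * ρ ≤ ‖v.2‖
    · refine le_trans ?_ le_self_add
      rw [hh₁, Set.indicator_of_mem (show v + e ∈ T from ⟨by nlinarith, by linarith⟩)]
      refine ENNReal.ofReal_le_ofReal ?_
      have h4 : 0 < ‖(v + e).2‖ := by linarith
      have h5 : ‖v.2‖⁻¹ ≤ 2 * ‖(v + e).2‖⁻¹ := by
        rw [inv_le_iff_one_le_mul₀ hy0, mul_right_comm, ← div_eq_mul_inv, one_le_div h4]
        linarith
      calc c * ‖v.2‖⁻¹ ^ m ≤ c * (2 * ‖(v + e).2‖⁻¹) ^ m := by gcongr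
        _ = _ := by rw [mul_pow, mul_assoc]
    · refine le_trans ?_ le_add_self
      push Not at hbig
      rw [hh₂, Set.indicator_of_mem]
      · refine ENNReal.ofReal_le_ofReal ?_
        refine mul_le_mul_of_nonneg_left (pow_le_pow_left₀ (by positivity) ?_ _) hc0
        rw [inv_le_iff_one_le_mul₀ hy0, div_mul_eq_mul_div, one_le_div hε]
        exact hv1
      · rw [mem_closedBall_zero_iff, Prod.norm_def]
        refine max_le ?_ ?_
        · nlinarith
        · nlinarith
  have hI₁ : ∫⁻ z, h₁ z ≤ ENNReal.ofReal (δ / 2) := by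
    refine (lintegral_cone_le (by positivity) (by positivity) (by positivity)).trans ?_
    refine ENNReal.ofReal_le_ofReal ?_
    have e1 : c * 2 ^ m * (2 * (4 * n + 1)) ^ m * (2 * (2 * (ε * M ^ m))) ^ n
        = C₁ * ε ^ (m + n) := by
      have : (M ^ n) ^ m = (M ^ m) ^ n := by rw [← pow_mul, ← pow_mul, mul_comm]
      have h4 : (4 : ℝ) ^ m = 2 ^ m * 2 ^ m := by rw [← mul_pow]; norm_num
      have h4' : (4 : ℝ) ^ n = 2 ^ n * 2 ^ n := by rw [← mul_pow]; norm_num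
      rw [hc, hC₁, h4, h4']
      simp only [mul_pow, inv_pow, pow_add]
      rw [this]
      field_simp
    rw [e1]
    calc C₁ * ε ^ (m + n) ≤ C₁ * ε := by
          gcongr
          exact pow_le_of_le_one hε.le (hεle.trans (min_le_left _ _)) (by omega)
      _ ≤ C₁ * (δ / 2 / C₁) := by
          gcongr
          exact hεle.trans (min_le_right _ _)
      _ = δ / 2 := by field_simp
  have hI₂ : ∫⁻ z, h₂ z ≤ ENNReal.ofReal (δ / 2) := by
    rw [hh₂, lintegral_indicator_const Metric.isClosed_closedBall.measurableSet,
      Measure.volume_eq_prod, ← Prod.mk_zero_zero, ← closedBall_prod_same, Measure.prod_prod,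
      Real.volume_pi_closedBall _ hR0, Real.volume_pi_closedBall _ hR0,
      ← ENNReal.ofReal_mul (by positivity), ← ENNReal.ofReal_mul (by positivity)]
    refine ENNReal.ofReal_le_ofReal ?_
    simp only [Fintype.card_fin]
    have e1 : c * (2 * n / ε) ^ m * ((2 * R) ^ m * (2 * R) ^ n) = C₂ * ((M ^ n) ^ m)⁻¹ := by
      have h4 : (4 : ℝ) ^ m = 2 ^ m * 2 ^ m := by rw [← mul_pow]; norm_num
      rw [hc, hC₂, pow_add]
      simp only [mul_pow, inv_pow, div_pow, h4]
      field_simp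
    rw [e1]
    have hMM : M ≤ (M ^ n) ^ m := by
      rw [← pow_mul]
      exact le_self_pow₀ (by linarith) (by positivity)
    rw [← div_eq_mul_inv, div_le_iff₀ (by positivity)]
    calc C₂ ≤ δ / 2 * M := by
          have := (le_max_right _ _).trans hM
          rw [div_le_iff₀ (by positivity)] at this
          linarith
      _ ≤ _ := by gcongr
  calc _ ≤ volume (⋃ z, {X : Fin m → Fin n → ℝ | (∀ i j, X i j ∈ Set.Icc (0 : ℝ) 1) ∧
        ε ≤ ‖ψ z + w‖ ∧ ‖flow M (X - X₀) (ψ z + w)‖ < ε}) := by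
        refine measure_mono ?_
        rintro X ⟨hX, z, hz⟩
        exact Set.mem_iUnion.2 ⟨z, hX, hz⟩
    _ ≤ ∑' z, volume {X : Fin m → Fin n → ℝ | (∀ i j, X i j ∈ Set.Icc (0 : ℝ) 1) ∧
        ε ≤ ‖ψ z + w‖ ∧ ‖flow M (X - X₀) (ψ z + w)‖ < ε} := measure_iUnion_le _
    _ ≤ ∑' z, g (ψ z + w) := by
        refine ENNReal.tsum_le_tsum fun z => ?_
        by_cases hz : ε ≤ ‖ψ z + w‖
        · simp only [hz, true_and]
          exact volume_bad_le hn hε hM2 hX₀ hz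
        · simp [hz]
    _ ≤ ∫⁻ z, (h₁ z + h₂ z) :=
        hψ.tsum_le_lintegral (h := fun z => h₁ z + h₂ z) (hcov ψ hψ hψε) (by fun_prop) hgh w
    _ = (∫⁻ z, h₁ z) + ∫⁻ z, h₂ z := lintegral_add_left hm₁ _
    _ ≤ ENNReal.ofReal (δ / 2) + ENNReal.ofReal (δ / 2) := add_le_add hI₁ hI₂
    _ = ENNReal.ofReal δ := by
        rw [← ENNReal.ofReal_add (by positivity) (by positivity), add_halves]

end Bad

section Cantor

/-- A family of points coded by `K`-ary sequences, in which codes that first differ at the `k`-th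
place give points at distance at least `c * R⁻¹ ^ k`, has dimension at least `log K / log R`. -/
lemma le_dimH_range_of_separated {X : Type*} [MetricSpace X] {K : ℕ} (hK : 1 < K) {R c : ℝ}
    (hR : 1 < R) (hc : 0 < c) {Φ : (ℕ → Fin K) → X}
    (h : ∀ ω ω' k, (∀ i < k, ω i = ω' i) → ω k ≠ ω' k → c * R⁻¹ ^ k ≤ dist (Φ ω) (Φ ω')) :
    ENNReal.ofReal (Real.log K / Real.log R) ≤ dimH (Set.range Φ) := by
  classical
  have hK1 : (1 : ℝ) < K := by exact_mod_cast hK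
  have hfirst (ω ω' : ℕ → Fin K) (hne : ω ≠ ω') :
      ∃ k, (∀ i < k, ω i = ω' i) ∧ ω k ≠ ω' k :=
    ⟨PiNat.firstDiff ω ω', fun i hi => PiNat.apply_eq_of_lt_firstDiff hi,
      PiNat.apply_firstDiff_ne hne⟩
  have hinj : Function.Injective Φ := by
    intro ω ω' heq
    by_contra hne
    obtain ⟨k, h1, h2⟩ := hfirst ω ω' hne
    have := h ω ω' k h1 h2
    rw [heq, dist_self] at this
    have : 0 < c * R⁻¹ ^ k := by positivity
    linarith
  have hlogR := Real.log_pos hR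
  have hlogK := Real.log_pos hK1
  set s : ℝ := Real.log K / Real.log R with hs
  have hs0 : 0 < s := div_pos hlogK hlogR
  have hRs : R ^ s = K := by
    rw [Real.rpow_def_of_pos (by linarith), hs, mul_div_cancel₀ _ hlogR.ne',
      Real.exp_log (by linarith)]
  have : Nonempty (ℕ → Fin K) := ⟨fun _ => ⟨0, by omega⟩⟩
  set f : X → ℝ := fun x => Real.ofDigits (Function.invFun Φ x)
  have hf (ω : ℕ → Fin K) : f (Φ ω) = Real.ofDigits ω := by
    simp only [f, Function.leftInverse_invFun hinj ω]
  have hH : HolderOnWith (Real.toNNReal ((c⁻¹) ^ s)) s.toNNReal f (Set.range Φ) := by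
    rintro _ ⟨ω, rfl⟩ _ ⟨ω', rfl⟩
    rw [hf, hf, edist_dist, edist_dist, Real.coe_toNNReal _ hs0.le,
      ENNReal.ofReal_rpow_of_nonneg dist_nonneg hs0.le]
    change _ ≤ ENNReal.ofReal _ * _
    rw [← ENNReal.ofReal_mul (by positivity)]
    refine ENNReal.ofReal_le_ofReal ?_
    by_cases hne : ω = ω'
    · rw [hne]; simp; positivity
    obtain ⟨k, h1, h2⟩ := hfirst ω ω' hne
    rw [← Real.mul_rpow (by positivity) dist_nonneg, Real.dist_eq]
    calc _ ≤ ((K : ℝ) ^ k)⁻¹ := Real.abs_ofDigits_sub_ofDigits_le h1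
      _ = (R⁻¹ ^ k) ^ s := by
        rw [inv_pow, Real.inv_rpow (by positivity), ← Real.rpow_natCast R k,
          ← Real.rpow_mul (by linarith), mul_comm, Real.rpow_mul (by linarith), hRs,
          Real.rpow_natCast]
      _ ≤ _ := by
        refine Real.rpow_le_rpow (by positivity) ?_ hs0.le
        rw [le_inv_mul_iff₀ hc]
        exact h ω ω' k h1 h2
  have him : Set.Icc (0 : ℝ) 1 ⊆ f '' Set.range Φ := by
    intro x hx
    obtain ⟨ω, -, rfl⟩ := Real.ofDigits_SurjOn hK hx
    exact ⟨Φ ω, ⟨ω, rfl⟩, hf ω⟩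
  have h1 : dimH (Set.Icc (0 : ℝ) 1) = 1 := by
    rw [Real.dimH_of_nonempty_interior (by simp)]
    simp
  have h2 := (dimH_mono him).trans (hH.dimH_image_le (by simpa using hs0))
  rw [h1] at h2
  have h3 := ENNReal.mul_le_of_le_div h2
  rw [one_mul] at h3
  exact h3

variable {m n : ℕ}

/-- Lower bound for the dimension of a Cantor set in which every cube has `K` children, each
of side `(2 N)⁻¹` times that of its parent and with its lower corner on a grid of
twice that spacing. -/
lemma le_dimH_of_tree {K N : ℕ} (hK : 1 < K) (hN : 0 < N) {l₀ : ℝ} (hl₀ : 0 < l₀)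
    {Good : ℕ → (Fin m → Fin n → ℝ) → Prop} {c₀ : Fin m → Fin n → ℝ} (h₀ : Good 0 c₀)
    (hstep : ∀ k c, Good k c → ∃ d : Fin K → Fin m → Fin n → Fin N, Function.Injective d ∧
      ∀ t, Good (k + 1) fun i j => c i j + 2 * (l₀ / (2 * N) ^ (k + 1)) * (d t i j : ℕ)) :
    ENNReal.ofReal (Real.log K / Real.log (2 * N)) ≤
      dimH {A : Fin m → Fin n → ℝ | ∀ k, ∃ c, Good k c ∧
        ∀ i j, A i j ∈ Set.Icc (c i j) (c i j + l₀ / (2 * N) ^ k)} := by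
  have hN1 : (1 : ℝ) ≤ N := by exact_mod_cast hN
  have hstep' : ∀ k c, ∃ d : Fin K → Fin m → Fin n → Fin N, Good k c → Function.Injective d ∧
      ∀ t, Good (k + 1) fun i j => c i j + 2 * (l₀ / (2 * N) ^ (k + 1)) * (d t i j : ℕ) := by
    intro k c
    by_cases hg : Good k c
    · obtain ⟨d, hd⟩ := hstep k c hg
      exact ⟨d, fun _ => hd⟩
    · exact ⟨fun _ _ _ => ⟨0, hN⟩, fun h => absurd h hg⟩
  choose d hd using hstep'
  set l : ℕ → ℝ := fun k => l₀ / (2 * N) ^ k with hl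
  have hl0 (k) : 0 < l k := by positivity
  have hls (k) : l k = 2 * N * l (k + 1) := by
    simp only [hl, pow_succ]
    field_simp
  let corner (ω : ℕ → Fin K) (k : ℕ) : Fin m → Fin n → ℝ :=
    Nat.rec c₀ (fun k c i j => c i j + 2 * l (k + 1) * (d k c (ω k) i j : ℕ)) k
  have hsucc (ω k) : corner ω (k + 1) =
      fun i j => corner ω k i j + 2 * l (k + 1) * (d k (corner ω k) (ω k) i j : ℕ) := rfl
  have hgood (ω k) : Good k (corner ω k) := by
    induction k with
    | zero => exact h₀
    | succ k ih => exact (hd k _ ih).2 _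
  have hcongr (ω ω' : ℕ → Fin K) (k) (h : ∀ i < k, ω i = ω' i) : corner ω k = corner ω' k := by
    induction k with
    | zero => rfl
    | succ k ih => rw [hsucc, hsucc, ih fun i hi => h i (by omega), h k (by omega)]
  let box (ω : ℕ → Fin K) (k : ℕ) : Set (Fin m → Fin n → ℝ) :=
    Set.Icc (corner ω k) fun i j => corner ω k i j + l k
  have hne (ω) : (⋂ k, box ω k).Nonempty := by
    refine IsCompact.nonempty_iInter_of_sequence_nonempty_isCompact_isClosed _ (fun k => ?_)
      (fun k => ?_) isCompact_Icc fun k => isClosed_Icc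
    · refine Set.Icc_subset_Icc (fun i j => ?_) fun i j => ?_
      · rw [hsucc]
        have := hl0 (k + 1)
        simp only [le_add_iff_nonneg_right]
        positivity
      · simp only [hsucc]
        have h1 : ((d k (corner ω k) (ω k) i j : ℕ) : ℝ) + 1 ≤ N := by
          exact_mod_cast (d k (corner ω k) (ω k) i j).2
        have := hl0 (k + 1)
        rw [hls k]
        nlinarith
    · exact Set.nonempty_Icc.2 fun i j => by simpa using (hl0 k).le
  choose Φ hΦ using hne
  have hΦ' (ω k i j) : Φ ω i j ∈ Set.Icc (corner ω k i j) (corner ω k i j + l k) := by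
    have := Set.mem_iInter.1 (hΦ ω) k
    exact ⟨this.1 i j, this.2 i j⟩
  refine (le_dimH_range_of_separated hK (R := 2 * N) (c := l 1) (Φ := Φ) (by linarith) (hl0 1)
    fun ω ω' k h1 h2 => ?_).trans (dimH_mono ?_)
  · have hlk : l 1 * (2 * N : ℝ)⁻¹ ^ k = l (k + 1) := by
      rw [inv_pow]
      simp only [hl, pow_succ, pow_zero]
      field_simp
    rw [hlk]
    have hdne : d k (corner ω k) (ω k) ≠ d k (corner ω k) (ω' k) :=
      fun h => h2 ((hd k _ (hgood ω k)).1 h)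
    obtain ⟨i, hi⟩ := Function.ne_iff.1 hdne
    obtain ⟨j, hj⟩ := Function.ne_iff.1 hi
    refine le_trans ?_ ((dist_le_pi_dist (Φ ω i) (Φ ω' i) j).trans (dist_le_pi_dist _ _ i))
    have e1 := hΦ' ω (k + 1) i j
    have e2 := hΦ' ω' (k + 1) i j
    rw [hsucc] at e1 e2
    rw [← hcongr ω ω' k h1] at e2
    simp only [Set.mem_Icc] at e1 e2
    have hl1 := hl0 (k + 1)
    rw [Real.dist_eq, le_abs]
    rcases lt_or_gt_of_ne (Fin.val_ne_of_ne hj) with hlt | hlt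
    · right
      have : ((d k (corner ω k) (ω k) i j : ℕ) : ℝ) + 1 ≤ (d k (corner ω k) (ω' k) i j : ℕ) := by
        exact_mod_cast hlt
      nlinarith
    · left
      have : ((d k (corner ω k) (ω' k) i j : ℕ) : ℝ) + 1 ≤ (d k (corner ω k) (ω k) i j : ℕ) := by
        exact_mod_cast hlt
      nlinarith
  · rintro _ ⟨ω, rfl⟩ k
    exact ⟨corner ω k, hgood ω k, hΦ' ω k⟩

end Cantor

section Children

variable {m n : ℕ}

/-- Among the `N ^ (m * n)` cubes of side `(2 * N)⁻¹` with lower corners in `N⁻¹ ℤ` inside the unit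
cube, at least half are not contained in a given set of measure at most `2⁻¹ ^ (m * n + 1)`. -/
lemma exists_injective_not_mem {N K : ℕ} (hN : 0 < N) (hK : 2 * K ≤ N ^ (m * n))
    {T : Set (Fin m → Fin n → ℝ)} (hT : volume T ≤ ENNReal.ofReal (2⁻¹ ^ (m * n + 1))) :
    ∃ d : Fin K → Fin m → Fin n → Fin N, Function.Injective d ∧ ∀ t, ∃ X ∉ T, ∀ i j,
      X i j ∈ Set.Icc (2 * (d t i j : ℕ) / (2 * N) : ℝ) ((2 * (d t i j : ℕ) + 1) / (2 * N)) := by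
  classical
  have hN0 : (0 : ℝ) < N := by exact_mod_cast hN
  let Q (d : Fin m → Fin n → Fin N) : Set (Fin m → Fin n → ℝ) :=
    Set.univ.pi fun i => Set.univ.pi fun j =>
      Set.Icc (2 * (d i j : ℕ) / (2 * N) : ℝ) ((2 * (d i j : ℕ) + 1) / (2 * N))
  have hQm (d) : MeasurableSet (Q d) :=
    .univ_pi fun i => .univ_pi fun j => measurableSet_Icc
  have hQv (d) : volume (Q d) = ENNReal.ofReal ((2 * (N : ℝ))⁻¹ ^ (m * n)) := by
    have (i : Fin m) (j : Fin n) :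
        ((2 * (d i j : ℕ) + 1) / (2 * N) - 2 * (d i j : ℕ) / (2 * N) : ℝ) = (2 * (N : ℝ))⁻¹ := by
      field_simp; ring
    simp only [Q, volume_pi_pi, Real.volume_Icc, this, Finset.prod_const, Finset.card_univ,
      Fintype.card_fin]
    rw [← pow_mul, mul_comm n m, ENNReal.ofReal_pow (by positivity)]
  have hQd : Pairwise (Function.onFun Disjoint Q) := by
    intro d d' hne
    rw [Function.onFun, Set.disjoint_left]
    intro X hX hX'
    refine hne (funext fun i => funext fun j => Fin.ext ?_)
    have h1 := hX i trivial j trivial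
    have h2 := hX' i trivial j trivial
    simp only [Set.mem_Icc, div_le_iff₀ (by positivity : (0 : ℝ) < 2 * N),
      le_div_iff₀ (by positivity : (0 : ℝ) < 2 * N)] at h1 h2
    have e1 : (2 * (d i j : ℕ) : ℝ) ≤ 2 * (d' i j : ℕ) + 1 := h1.1.trans h2.2
    have e2 : (2 * (d' i j : ℕ) : ℝ) ≤ 2 * (d i j : ℕ) + 1 := h2.1.trans h1.2
    norm_cast at e1 e2
    omega
  let B : Finset (Fin m → Fin n → Fin N) := {d | Q d ⊆ T}
  have hB : 2 * B.card ≤ N ^ (m * n) := by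
    have h1 : volume (⋃ d ∈ B, Q d) ≤ ENNReal.ofReal (2⁻¹ ^ (m * n + 1)) :=
      (measure_mono (Set.iUnion₂_subset fun d hd => by simpa [B] using hd)).trans hT
    rw [measure_biUnion_finset (fun d _ d' _ h => hQd h) fun d _ => hQm d] at h1
    simp only [hQv, Finset.sum_const, nsmul_eq_mul] at h1
    rw [← ENNReal.ofReal_natCast, ← ENNReal.ofReal_mul (by positivity),
      ENNReal.ofReal_le_ofReal_iff (by positivity), mul_inv, mul_pow, pow_succ, inv_pow (N : ℝ),
      mul_left_comm, mul_le_mul_iff_of_pos_left (by positivity), ← div_eq_mul_inv,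
      div_le_iff₀ (by positivity)] at h1
    have : (2 * B.card : ℝ) ≤ (N : ℝ) ^ (m * n) := by linarith
    exact_mod_cast this
  have hG : K ≤ Bᶜ.card := by
    rw [Finset.card_compl]
    simp only [Fintype.card_pi, Fintype.card_fin, Finset.prod_const, Finset.card_univ]
    rw [← pow_mul, mul_comm n m]
    omega
  obtain ⟨G, hGB, hGc⟩ := Finset.exists_subset_card_eq hG
  refine ⟨fun t => (G.equivFinOfCardEq hGc).symm t,
    Subtype.val_injective.comp (Equiv.injective _), fun t => ?_⟩
  have ht := hGB ((G.equivFinOfCardEq hGc).symm t).2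
  simp only [B, Finset.mem_compl, Finset.mem_filter_univ, Set.not_subset] at ht
  obtain ⟨X, hX, hXT⟩ := ht
  exact ⟨X, hXT, fun i j => hX i trivial j trivial⟩

lemma flow_mul {S M : ℝ} (hS : 0 < S) (A A' : Fin m → Fin n → ℝ)
    (z : (Fin m → ℝ) × (Fin n → ℝ)) :
    flow (S * M) A' z = flow M (fun i j => S ^ (m + n) * (A' i j - A i j)) (flow S A z) := by
  ext i
  · have : ∑ j, S ^ (m + n) * (A' i j - A i j) * ((S ^ m)⁻¹ * z.2 j) =
        S ^ n * (∑ j, A' i j * z.2 j - ∑ j, A i j * z.2 j) := by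
      rw [← Finset.sum_sub_distrib, Finset.mul_sum]
      refine Finset.sum_congr rfl fun j _ => ?_
      rw [pow_add]
      field_simp
    simp only [flow, this]
    ring
  · simp only [flow, mul_pow, mul_inv]
    ring

lemma flow_add (S : ℝ) (A : Fin m → Fin n → ℝ) (z w : (Fin m → ℝ) × (Fin n → ℝ)) :
    flow S A (z + w) = flow S A z + flow S A w := by
  ext i
  · simp [flow, mul_add, Finset.sum_add_distrib]; ring
  · simp [flow, mul_add]

/-- Some point `A` of the cube with lower corner `c` and side `S⁻¹ ^ (m + n)` is such that the
images under `flow S A` of the integer lattice and of its translate by `b` have no vector of norm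
less than `ε`, apart from the origin in the first case. -/
def IsGoodCube (ε : ℝ) (b : Fin m → ℝ) (S : ℝ) (c : Fin m → Fin n → ℝ) : Prop :=
  ∃ A : Fin m → Fin n → ℝ, (∀ i j, A i j ∈ Set.Icc (c i j) (c i j + (S ^ (m + n))⁻¹)) ∧
    (∀ z ≠ 0, ε ≤ ‖latticeMap S A z‖) ∧ ∀ z, ε ≤ ‖latticeMap S A z + flow S A (b, 0)‖

lemma exists_isGoodCube_children (hm : 0 < m) (hn : 0 < n) :
    ∃ ε₀ > 0, ∀ ε : ℝ, 0 < ε → ε ≤ ε₀ → ∃ M₀ : ℝ, ∀ M ≥ M₀, 0 < M → ∀ N K : ℕ,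
      M ^ (m + n) = 2 * N → 2 * K ≤ N ^ (m * n) → ∀ S > 0, ∀ (b : Fin m → ℝ)
      (c : Fin m → Fin n → ℝ), IsGoodCube ε b S c → ∃ d : Fin K → Fin m → Fin n → Fin N,
        Function.Injective d ∧ ∀ t, IsGoodCube ε b (S * M)
          fun i j => c i j + 2 * ((S * M) ^ (m + n))⁻¹ * (d t i j : ℕ) := by
  obtain ⟨ε₀, hε₀, H⟩ := exists_volume_bad_le hm hn
    (δ := 2⁻¹ ^ (m * n + 2)) (by positivity)
  refine ⟨ε₀, hε₀, fun ε hε hle => ?_⟩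
  obtain ⟨M₀, H⟩ := H ε hε hle
  refine ⟨M₀, fun M hM hM0 N K hMN hK S hS b c ⟨A, hA, hA1, hA2⟩ => ?_⟩
  have hN : 0 < N := by
    rcases Nat.eq_zero_or_pos N with h | h
    · rw [h, Nat.cast_zero, mul_zero] at hMN
      exact absurd hMN (by positivity)
    · exact h
  have hN0 : (0 : ℝ) < N := by exact_mod_cast hN
  have hSp : 0 < S ^ (m + n) := by positivity
  set X₀ : Fin m → Fin n → ℝ := fun i j => S ^ (m + n) * (A i j - c i j) with hX₀
  have hX₀1 (i j) : X₀ i j ∈ Set.Icc (0 : ℝ) 1 := by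
    obtain ⟨h1, h2⟩ := hA i j
    refine ⟨mul_nonneg hSp.le (by linarith), ?_⟩
    simp only [hX₀]
    rw [← le_div_iff₀' hSp, one_div]
    linarith
  have H' := H M hM (latticeMap S A) (unitCovolume_latticeMap hS A) hA1
  have e1 := H' 0 X₀ hX₀1
  have e2 := H' (flow S A (b, 0)) X₀ hX₀1
  have e3 := (measure_union_le _ _).trans (add_le_add e1 e2)
  rw [← ENNReal.ofReal_add (by positivity) (by positivity), pow_succ,
    ← mul_add, show (2⁻¹ + 2⁻¹ : ℝ) = 1 by norm_num, mul_one] at e3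
  obtain ⟨d, hd, hd'⟩ := exists_injective_not_mem hN hK e3
  refine ⟨d, hd, fun t => ?_⟩
  obtain ⟨X, hXT, hX⟩ := hd' t
  have hX1 (i j) : X i j ∈ Set.Icc (0 : ℝ) 1 := by
    obtain ⟨h1, h2⟩ := hX i j
    have : ((d t i j : ℕ) : ℝ) + 1 ≤ N := by exact_mod_cast (d t i j).2
    refine ⟨le_trans (by positivity) h1, h2.trans ?_⟩
    rw [div_le_one (by positivity)]
    linarith
  set A' : Fin m → Fin n → ℝ := fun i j => c i j + (S ^ (m + n))⁻¹ * X i j with hA'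
  have hXA : (fun i j => S ^ (m + n) * (A' i j - A i j)) = X - X₀ := by
    ext i j
    simp only [hA', hX₀, Pi.sub_apply]
    field_simp
    ring
  have hflow (z) : flow (S * M) A' z = flow M (X - X₀) (flow S A z) := by
    rw [flow_mul hS A A' z, hXA]
  rw [Set.mem_union, not_or] at hXT
  refine ⟨A', fun i j => ?_, fun z hz => ?_, fun z => ?_⟩
  · obtain ⟨h1, h2⟩ := hX i j
    rw [mul_pow, hMN]
    simp only [hA', Set.mem_Icc, mul_inv_rev]
    have hSi : 0 < (S ^ (m + n))⁻¹ := by positivity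
    have e1 := mul_le_mul_of_nonneg_left h1 hSi.le
    have e2 := mul_le_mul_of_nonneg_left h2 hSi.le
    have e3 : (S ^ (m + n))⁻¹ * (2 * (d t i j : ℕ) / (2 * N)) =
      2 * ((↑N)⁻¹ * 2⁻¹ * (S ^ (m + n))⁻¹) * (d t i j : ℕ) := by field_simp
    have e4 : (S ^ (m + n))⁻¹ * ((2 * (d t i j : ℕ) + 1) / (2 * N)) =
      2 * ((↑N)⁻¹ * 2⁻¹ * (S ^ (m + n))⁻¹) * (d t i j : ℕ) +
        (↑N)⁻¹ * 2⁻¹ * (S ^ (m + n))⁻¹ := by field_simp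
    constructor <;> linarith
  · by_contra hlt
    refine hXT.1 ⟨hX1, z, ?_, ?_⟩
    · rw [add_zero]; exact hA1 z hz
    · rw [add_zero]
      exact (congrArg norm (hflow _)).symm.trans_lt (not_le.1 hlt)
  · by_contra hlt
    refine hXT.2 ⟨hX1, z, hA2 z, ?_⟩
    rw [flow_add, ← hflow]
    exact (congrArg (‖· + _‖) (hflow _)).symm.trans_lt (not_le.1 hlt)

end Children

section Thick

variable {m n : ℕ}

lemma norm_flow_one_le {B : Fin m → Fin n → ℝ} (hB : ∀ i j, |B i j| ≤ 1)
    (z : (Fin m → ℝ) × (Fin n → ℝ)) : ‖flow 1 B z‖ ≤ (1 + n) * ‖z‖ := by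
  have hn : (0 : ℝ) ≤ n := n.cast_nonneg
  have h2 (j) : |z.2 j| ≤ ‖z‖ := (norm_le_pi_norm z.2 j).trans (norm_snd_le z)
  have h0 : 0 ≤ (1 + n) * ‖z‖ := by positivity
  rw [Prod.norm_def, max_le_iff, pi_norm_le_iff_of_nonneg h0, pi_norm_le_iff_of_nonneg h0]
  refine ⟨fun i => ?_, fun j => ?_⟩
  · simp only [flow, one_pow, one_mul, Real.norm_eq_abs]
    have h1 : |z.1 i| ≤ ‖z‖ := (norm_le_pi_norm z.1 i).trans (norm_fst_le z)
    have h3 : |∑ j, B i j * z.2 j| ≤ n * ‖z‖ := by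
      refine (Finset.abs_sum_le_sum_abs _ _).trans ?_
      refine (Finset.sum_le_card_nsmul _ _ ‖z‖ fun j _ => ?_).trans (by simp)
      rw [abs_mul]
      exact (mul_le_of_le_one_left (abs_nonneg _) (hB i j)).trans (h2 j)
    have := abs_add_le (∑ j, B i j * z.2 j) (z.1 i)
    linarith
  · simp only [flow, one_pow, inv_one, one_mul, Real.norm_eq_abs]
    have := mul_nonneg hn (norm_nonneg z)
    linarith [h2 j]

lemma IsGoodCube.le_norm_flow {ε S : ℝ} {b : Fin m → ℝ} {c : Fin m → Fin n → ℝ} (hS : 0 < S)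
    (h : IsGoodCube ε b S c) {A : Fin m → Fin n → ℝ}
    (hA : ∀ i j, A i j ∈ Set.Icc (c i j) (c i j + (S ^ (m + n))⁻¹))
    (p : Fin m → ℤ) (q : Fin n → ℤ) :
    ε / (1 + n) ≤ ‖flow S A (intCast p + b, intCast q)‖ := by
  obtain ⟨A', hA', -, hε⟩ := h
  have hn : (0 : ℝ) ≤ n := n.cast_nonneg
  have hSp : 0 < S ^ (m + n) := by positivity
  have h1 : ε ≤ ‖flow S A' (intCast p + b, intCast q)‖ := by
    refine (hε (p, q)).trans_eq (congrArg norm ?_)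
    refine (flow_add S A' (intCast p, intCast q) (b, 0)).symm.trans ?_
    rw [Prod.mk_add_mk, add_zero]
  have h2 := flow_mul (M := 1) hS A A' (intCast p + b, intCast q)
  rw [mul_one] at h2
  rw [h2] at h1
  rw [div_le_iff₀' (by positivity)]
  refine h1.trans (norm_flow_one_le (fun i j => ?_) _)
  rw [abs_mul, abs_of_pos hSp, ← le_div_iff₀' hSp, one_div, abs_le]
  have e1 := hA i j
  have e2 := hA' i j
  simp only [Set.mem_Icc] at e1 e2
  constructor <;> linarith

lemma isBadlyApproximable_of_le_norm_flow (hm : 0 < m) {A : Fin m → Fin n → ℝ} {b : Fin m → ℝ}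
    {ε L M : ℝ} (hε : 0 < ε) (hL : 0 < L) (hM : 1 < M)
    (h : ∀ k : ℕ, ∀ p q, ε ≤ ‖flow (L * M ^ k) A (intCast p + b, intCast q)‖) :
    IsBadlyApproximable A b := by
  classical
  refine ⟨ε ^ (m + n) * (M ^ (m * n))⁻¹, by positivity, ε * L ^ m, fun p q hq => ?_⟩
  have hex : ∃ k : ℕ, ‖intCast q‖ < ε * (L * M ^ k) ^ m := by
    have : Tendsto (fun k : ℕ => ε * (L * M ^ k) ^ m) atTop atTop :=
      ((tendsto_pow_atTop hm.ne').comp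
        ((tendsto_pow_atTop_atTop_of_one_lt hM).const_mul_atTop hL)).const_mul_atTop hε
    exact (this.eventually_gt_atTop _).exists
  obtain ⟨k, hk⟩ : ∃ k, Nat.find hex = k + 1 := by
    refine Nat.exists_eq_succ_of_ne_zero fun h0 => ?_
    have := Nat.find_spec hex
    rw [h0, pow_zero, mul_one] at this
    linarith
  have h1 := Nat.find_spec hex
  have h2 := not_lt.1 (Nat.find_min hex (m := k) (by omega))
  rw [hk] at h1
  have hS' : 0 < L * M ^ k := by positivity
  have hS : 0 < L * M ^ (k + 1) := by positivity
  have h3 : ε * ((L * M ^ (k + 1)) ^ n)⁻¹ ≤ ‖affForm A b q p‖ := by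
    by_contra hlt
    refine (h (k + 1) p q).not_gt ((norm_flow_lt_iff hε hS).2 ⟨fun i => ?_, h1⟩)
    refine lt_of_eq_of_lt ?_ ((norm_le_pi_norm (affForm A b q p) i).trans_lt (not_le.1 hlt))
    rw [Real.norm_eq_abs]
    congr 1
    simp only [affForm, intCast, Pi.add_apply]
    ring
  calc ε ^ (m + n) * (M ^ (m * n))⁻¹
      = (ε * ((L * M ^ (k + 1)) ^ n)⁻¹) ^ m * (ε * (L * M ^ k) ^ m) ^ n := by
        rw [pow_succ, ← mul_assoc L, mul_pow (L * M ^ k) M]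
        generalize L * M ^ k = S at hS'
        rw [mul_pow, mul_pow, inv_pow, mul_pow, ← pow_mul, ← pow_mul, ← pow_mul, mul_comm n m,
          pow_add]
        field_simp
    _ ≤ _ := by gcongr

lemma isGoodCube_of_le {ε L : ℝ} (hL : 1 ≤ L) {b : Fin m → ℝ} (i₀ : Fin m)
    (hεL : ε ≤ (L ^ m)⁻¹) (hεb : ε ≤ |b i₀ - round (b i₀)|) (A : Fin m → Fin n → ℝ) :
    IsGoodCube ε b L A := by
  have hL0 : 0 < L := by linarith
  have hLn : 1 ≤ L ^ n := one_le_pow₀ hL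
  have hε1 : ε ≤ 1 := hεL.trans (inv_le_one_of_one_le₀ (one_le_pow₀ hL))
  have h2 (z : (Fin m → ℤ) × (Fin n → ℤ)) (hz : z.2 ≠ 0) (w : (Fin m → ℝ) × (Fin n → ℝ))
      (hw : w.2 = 0) : ε ≤ ‖latticeMap L A z + w‖ := by
    obtain ⟨j, hj⟩ := Function.ne_iff.1 hz
    have h1 : (1 : ℝ) ≤ |(z.2 j : ℝ)| := by
      exact_mod_cast Int.one_le_abs hj
    refine le_trans ?_ ((norm_le_pi_norm _ j).trans (norm_snd_le (latticeMap L A z + w)))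
    change ε ≤ ‖(L ^ m)⁻¹ * (z.2 j : ℝ) + w.2 j‖
    rw [hw, Pi.zero_apply, add_zero, norm_mul, Real.norm_eq_abs, Real.norm_eq_abs,
      abs_of_pos (by positivity)]
    exact hεL.trans (le_mul_of_one_le_right (by positivity) h1)
  refine ⟨A, fun i j => ⟨le_rfl, by simp; positivity⟩, fun z hz => ?_, fun z => ?_⟩
  · by_cases hz2 : z.2 = 0
    · have hz1 : z.1 ≠ 0 := fun h => hz (Prod.ext h hz2)
      obtain ⟨i, hi⟩ := Function.ne_iff.1 hz1
      have h1 : (1 : ℝ) ≤ |(z.1 i : ℝ)| := by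
        exact_mod_cast Int.one_le_abs hi
      refine le_trans ?_ ((norm_le_pi_norm _ i).trans (norm_fst_le (latticeMap L A z)))
      change ε ≤ ‖L ^ n * ((∑ j, A i j * (z.2 j : ℝ)) + (z.1 i : ℝ))‖
      simp only [hz2, Pi.zero_apply, Int.cast_zero, mul_zero, Finset.sum_const_zero, zero_add]
      rw [norm_mul, Real.norm_eq_abs, Real.norm_eq_abs, abs_of_pos (by positivity)]
      exact hε1.trans (one_le_mul_of_one_le_of_one_le hLn h1)
    · simpa using h2 z hz2 0 rfl
  · by_cases hz2 : z.2 = 0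
    · refine le_trans ?_ ((norm_le_pi_norm _ i₀).trans
        (norm_fst_le (latticeMap L A z + flow L A (b, 0))))
      change ε ≤ ‖L ^ n * ((∑ j, A i₀ j * (z.2 j : ℝ)) + (z.1 i₀ : ℝ)) +
        L ^ n * ((∑ j, A i₀ j * 0) + b i₀)‖
      simp only [hz2, Pi.zero_apply, Int.cast_zero, mul_zero, Finset.sum_const_zero, zero_add]
      rw [← mul_add, norm_mul, Real.norm_eq_abs, Real.norm_eq_abs, abs_of_pos (by positivity)]
      have h1 := round_le (b i₀) (-z.1 i₀)
      rw [Int.cast_neg, sub_neg_eq_add, add_comm] at h1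
      exact (hεb.trans h1).trans (le_mul_of_one_le_left (abs_nonneg _) hLn)
    · refine h2 z hz2 _ ?_
      ext j
      simp [flow]

/-- If some coordinate of `b` is not an integer, then the matrices `A` for which `⟨A, b⟩` is
badly approximable form a set of full dimension in every nonempty open set. -/
lemma le_dimH_inter_isBadlyApproximable (hm : 0 < m) (hn : 0 < n) {b : Fin m → ℝ} (i₀ : Fin m)
    (hb : ∀ z : ℤ, b i₀ ≠ z) {W : Set (Fin m → Fin n → ℝ)} (hW : IsOpen W) (hne : W.Nonempty) :
    ((m * n : ℕ) : ENNReal) ≤ dimH (W ∩ {A | IsBadlyApproximable A b}) := by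
  obtain ⟨A₀, hA₀⟩ := hne
  obtain ⟨r, hr, hball⟩ := Metric.isOpen_iff.1 hW A₀ hA₀
  obtain ⟨ε₀, hε₀, H⟩ := exists_isGoodCube_children hm hn
  set L : ℝ := max 1 (2 / r) with hL
  have hL1 : 1 ≤ L := le_max_left _ _
  have hL0 : 0 < L := by linarith
  have hLr : (L ^ (m + n))⁻¹ < r := by
    have h1 : 2 / r ≤ L ^ (m + n) :=
      (le_max_right _ _).trans (le_self_pow₀ hL1 (by omega))
    rw [inv_lt_comm₀ (by positivity) hr]
    refine lt_of_lt_of_le ?_ h1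
    rw [inv_eq_one_div]
    gcongr
    norm_num
  have hb' : 0 < |b i₀ - round (b i₀)| := abs_pos.2 (sub_ne_zero.2 (hb _))
  set ε : ℝ := min ε₀ (min (L ^ m)⁻¹ |b i₀ - round (b i₀)|) with hε
  have hε0 : 0 < ε := by positivity
  obtain ⟨M₀, H⟩ := H ε hε0 (min_le_left _ _)
  have hgood₀ : IsGoodCube ε b L A₀ := isGoodCube_of_le hL1 i₀
    ((min_le_right _ _).trans (min_le_left _ _)) ((min_le_right _ _).trans (min_le_right _ _)) A₀
  have hD : 0 < m * n := Nat.mul_pos hm hn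
  have h2N : Tendsto (fun N : ℕ => 2 * (N : ℝ)) atTop atTop :=
    tendsto_natCast_atTop_atTop.const_mul_atTop two_pos
  have hbound : ∀ᶠ N : ℕ in atTop, ENNReal.ofReal
      ((m * n : ℕ) - (m * n + 2 : ℕ) * Real.log 2 / Real.log (2 * N)) ≤
        dimH (W ∩ {A | IsBadlyApproximable A b}) := by
    have hmn : 0 < ((m + n : ℕ) : ℝ)⁻¹ := by positivity
    have hMt := (tendsto_rpow_atTop hmn).comp h2N
    filter_upwards [hMt.eventually_ge_atTop M₀, hMt.eventually_gt_atTop 1,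
      eventually_ge_atTop 4] with N hM hM1 hN4
    simp only [Function.comp_apply] at hM hM1
    set M : ℝ := (2 * (N : ℝ)) ^ ((m + n : ℕ) : ℝ)⁻¹ with hMdef
    have hMN : M ^ (m + n) = 2 * N := Real.rpow_inv_natCast_pow (by positivity) (by omega)
    have hM0 : 0 < M := by linarith
    have hND : 4 ≤ N ^ (m * n) := hN4.trans (Nat.le_self_pow hD.ne' N)
    set K : ℕ := N ^ (m * n) / 2 with hK
    have hK1 : 1 < K := by omega
    have hN0 : (0 : ℝ) < N := by positivity
    have hside (k : ℕ) : (L ^ (m + n))⁻¹ / (2 * N) ^ k = ((L * M ^ k) ^ (m + n))⁻¹ := by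
      rw [← hMN, mul_pow, mul_inv, ← pow_mul, ← pow_mul, mul_comm k, div_eq_mul_inv]
    have htree := le_dimH_of_tree hK1 (by omega : 0 < N) (l₀ := (L ^ (m + n))⁻¹) (by positivity)
      (Good := fun k c => IsGoodCube ε b (L * M ^ k) c ∧ (k = 0 → c = A₀)) (c₀ := A₀)
      ⟨by simpa using hgood₀, fun _ => rfl⟩ fun k c hc => by
        obtain ⟨d, hd, hd'⟩ := H M hM hM0 N K hMN (by omega) (L * M ^ k) (by positivity) b c hc.1
        refine ⟨d, hd, fun t => ⟨?_, by simp⟩⟩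
        rw [hside, pow_succ, ← mul_assoc]
        exact hd' t
    refine le_trans (ENNReal.ofReal_le_ofReal ?_) (htree.trans (dimH_mono fun A hA => ⟨?_, ?_⟩))
    · have hlog : 0 < Real.log (2 * N) :=
        Real.log_pos (by have : (4 : ℝ) ≤ N := by exact_mod_cast hN4
                         linarith)
      rw [le_div_iff₀ hlog, sub_mul, div_mul_cancel₀ _ hlog.ne']
      have hK4 : (N : ℝ) ^ (m * n) / 4 ≤ K := by
        rw [div_le_iff₀ (by norm_num)]
        have : N ^ (m * n) ≤ K * 4 := by omega
        exact_mod_cast this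
      have h4 : Real.log 4 = 2 * Real.log 2 := by
        rw [show (4 : ℝ) = 2 ^ 2 by norm_num, Real.log_pow]
        norm_num
      have := Real.log_le_log (by positivity) hK4
      rw [Real.log_div (by positivity) (by norm_num), Real.log_pow, h4] at this
      rw [Real.log_mul (by norm_num) hN0.ne']
      push_cast at this ⊢
      linarith
    · obtain ⟨c, ⟨-, hc⟩, hcA⟩ := hA 0
      rw [hc rfl, pow_zero, div_one] at hcA
      refine hball ?_
      rw [Metric.mem_ball, dist_pi_lt_iff hr]
      refine fun i => (dist_pi_lt_iff hr).2 fun j => ?_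
      have := hcA i j
      simp only [Set.mem_Icc] at this
      rw [Real.dist_eq, abs_lt]
      constructor <;> linarith
    · refine isBadlyApproximable_of_le_norm_flow hm (ε := ε / (1 + n)) (by positivity) hL0 hM1
        fun k p q => ?_
      obtain ⟨c, ⟨hc, -⟩, hcA⟩ := hA k
      rw [hside] at hcA
      exact hc.le_norm_flow (by positivity) hcA p q
  have hlim : Tendsto (fun N : ℕ => ENNReal.ofReal
      ((m * n : ℕ) - (m * n + 2 : ℕ) * Real.log 2 / Real.log (2 * N))) atTop
      (nhds (ENNReal.ofReal ((m * n : ℕ) - 0))) :=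
    ENNReal.tendsto_ofReal (tendsto_const_nhds.sub
      ((Real.tendsto_log_atTop.comp h2N).const_div_atTop _))
  rw [sub_zero, ENNReal.ofReal_natCast] at hlim
  exact le_of_tendsto hlim hbound

end Thick

/-- The set of vectors `b ∈ ℝ^m` such that `{A : ⟨A, b⟩ is badly approximable}` is
thick in `M_{m,n}(ℝ)` is itself thick in `ℝ^m`. -/
theorem thick_slices_thick (m n : ℕ) (hm : 0 < m) (hn : 0 < n)
    (U : Set (Fin m → ℝ)) (hUopen : IsOpen U) (hUne : U.Nonempty) :
    dimH (U ∩ {b : Fin m → ℝ |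
      ∀ W : Set (Fin m → Fin n → ℝ), IsOpen W → W.Nonempty →
        dimH (W ∩ {A | IsBadlyApproximable A b}) = (m * n : ℕ)}) = (m : ℕ) := by
  refine le_antisymm ((dimH_mono (Set.subset_univ _)).trans_eq (Real.dimH_univ_pi_fin m)) ?_
  let V : Set (Fin m → ℝ) := {b | ∃ z : ℤ, b ⟨0, hm⟩ = z}ᶜ
  have hV : IsOpen V := by
    rw [isOpen_compl_iff]
    have : {b : Fin m → ℝ | ∃ z : ℤ, b ⟨0, hm⟩ = z} =
        (fun b => b ⟨0, hm⟩) ⁻¹' Set.range ((↑) : ℤ → ℝ) := by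
      ext b
      simp [eq_comm]
    rw [this]
    exact Int.isClosedEmbedding_coe_real.isClosed_range.preimage (continuous_apply _)
  have hUV : (U ∩ V).Nonempty := by
    obtain ⟨u, hu⟩ := hUne
    have hc : Tendsto (fun x : ℝ => Function.update u ⟨0, hm⟩ x) (nhds (u ⟨0, hm⟩)) (nhds u) := by
      have := (continuous_const.update (⟨0, hm⟩ : Fin m) continuous_id : Continuous
        fun x : ℝ => Function.update u ⟨0, hm⟩ x).tendsto (u ⟨0, hm⟩)
      simpa using this
    obtain ⟨x, hx, hx'⟩ := ((Set.countable_range ((↑) : ℤ → ℝ)).dense_compl ℝ).inter_nhds_nonempty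
      (hc (hUopen.mem_nhds hu))
    refine ⟨Function.update u ⟨0, hm⟩ x, hx', ?_⟩
    rintro ⟨z, hz⟩
    rw [Function.update_self] at hz
    exact hx ⟨z, hz.symm⟩
  calc (m : ENNReal) = dimH (U ∩ V) := by
        rw [Real.dimH_of_nonempty_interior (by rwa [(hUopen.inter hV).interior_eq])]
        simp
    _ ≤ _ := dimH_mono ?_
  rintro b ⟨hbU, hbV⟩
  refine ⟨hbU, fun W hW hne => le_antisymm ?_ ?_⟩
  · refine (dimH_mono (Set.subset_univ _)).trans_eq ?_
    rw [Real.dimH_univ_eq_finrank]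
    simp [Module.finrank_pi_fintype]
  · exact le_dimH_inter_isBadlyApproximable hm hn ⟨0, hm⟩ (fun z hz => hbV ⟨z, hz⟩) hW hne
end
end
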